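/- For every integer d ≥ 2, the Cantor–Bendixson rank of the space S^d of d-dimensional shifts (with the Hausdorff metric δ_H) is infinite: for every n ∈ ℕ, the n-th Cantor–Bendixson derivative of S^d contains an isolated point, hence the (n+1)-st derivative is a proper subset of the n-th derivative. -/

import Mathlib

/-- The group `ℤ^d`. -/
abbrev ZD (d : ℕ) := Fin d → ℤ

/-- A configuration is a map `ℤ^d → ℤ`. -/
abbrev Config (d : ℕ) := ZD d → ℤ

/-- The shift map `σ^u`, defined by `σ^u(x)_v = x_{u+v}`. -/
def shiftMap {d : ℕ} (u : ZD d) (x : Config d) : Config d := fun v => x (u + v)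

/-- The sup norm `‖·‖_∞` on `ℤ^d`, valued in `ℕ`. -/
def normInf {d : ℕ} (n : ZD d) : ℕ := Finset.univ.sup fun i => (n i).natAbs

open Classical in
/-- The metric `δ` on configurations: `δ(x,y) = 2^{-min{‖n‖_∞ : x_n ≠ y_n}}`, `δ(x,x) = 0`. -/
noncomputable def deltaDist {d : ℕ} (x y : Config d) : ℝ :=
  if x = y then 0
  else (2 : ℝ) ^ (-((sInf {m : ℕ | ∃ n : ZD d, normInf n = m ∧ x n ≠ y n} : ℕ) : ℤ))

/-- The closure of a set of configurations with respect to the metric `δ`. -/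
def deltaClosure {d : ℕ} (A : Set (Config d)) : Set (Config d) :=
  {x | ∀ ε : ℝ, 0 < ε → ∃ a ∈ A, deltaDist x a < ε}

/-- A set of configurations is closed for `δ` when it contains all its limit points. -/
def IsDeltaClosed {d : ℕ} (A : Set (Config d)) : Prop := deltaClosure A ⊆ A

/-- A `d`-dimensional shift: a nonempty set of configurations over a common finite
alphabet, closed for `δ` and invariant under every shift map. -/
def IsShift {d : ℕ} (X : Set (Config d)) : Prop :=
  X.Nonempty ∧ (∃ A : Finset ℤ, ∀ x ∈ X, ∀ v : ZD d, x v ∈ A) ∧ IsDeltaClosed X ∧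
    ∀ u : ZD d, ∀ x ∈ X, shiftMap u x ∈ X

/-- The Hausdorff metric `δ_H` on the space of shifts. -/
noncomputable def deltaH {d : ℕ} (X Z : Set (Config d)) : ℝ :=
  max (⨆ x : X, ⨅ z : Z, deltaDist (x : Config d) (z : Config d))
      (⨆ z : Z, ⨅ x : X, deltaDist (x : Config d) (z : Config d))

/-- A subsystem of a shift `X`: a nonempty closed shift-invariant subset of `X`. -/
def IsSubsystem {d : ℕ} (Z X : Set (Config d)) : Prop :=
  Z.Nonempty ∧ Z ⊆ X ∧ IsDeltaClosed Z ∧ ∀ u : ZD d, ∀ z ∈ Z, shiftMap u z ∈ Z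

/-- A maximal subsystem of `X`: a proper subsystem such that any subsystem strictly
between it and `X` equals `X`. -/
def IsMaximalSubsystem {d : ℕ} (Z X : Set (Config d)) : Prop :=
  IsSubsystem Z X ∧ Z ≠ X ∧ ∀ Z', IsSubsystem Z' X → Z ⊂ Z' → Z' = X

/-- An outcast of `X`: a proper subsystem contained in no maximal subsystem of `X`. -/
def IsOutcast {d : ℕ} (Z X : Set (Config d)) : Prop :=
  IsSubsystem Z X ∧ Z ≠ X ∧ ∀ M, IsMaximalSubsystem M X → ¬ Z ⊆ M

/-- A pattern with finite support `U` (given by the values of `p` on `U`) appears in the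
configuration `x`. -/
def PatternAppears {d : ℕ} (U : Finset (ZD d)) (p : ZD d → ℤ) (x : Config d) : Prop :=
  ∃ u : ZD d, ∀ v ∈ U, x (u + v) = p v

/-- The set of configurations over the alphabet `A` avoiding every pattern in `F`. -/
def XofF {d : ℕ} (A : Finset ℤ) (F : Set (Finset (ZD d) × (ZD d → ℤ))) : Set (Config d) :=
  {x | (∀ v : ZD d, x v ∈ A) ∧ ∀ q ∈ F, ¬ PatternAppears q.1 q.2 x}

/-- A shift of finite type: defined by a finite alphabet and a finite set of forbidden
patterns. -/
def IsSFT {d : ℕ} (X : Set (Config d)) : Prop :=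
  ∃ (A : Finset ℤ) (F : Finset (Finset (ZD d) × (ZD d → ℤ))), X = XofF A (F : Set _)

/-- `X` is an isolated point of the subspace `S` (with the Hausdorff metric `δ_H`). -/
def IsolatedIn {d : ℕ} (S : Set (Set (Config d))) (X : Set (Config d)) : Prop :=
  X ∈ S ∧ ∃ ε : ℝ, 0 < ε ∧ ∀ Z ∈ S, deltaH X Z < ε → Z = X

/-- The orbit of a configuration under the shift action. -/
def orbit {d : ℕ} (x : Config d) : Set (Config d) := {y | ∃ u : ZD d, y = shiftMap u x}

/-- A shift is transitive when some point has dense orbit. -/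
def IsTransitive {d : ℕ} (X : Set (Config d)) : Prop :=
  IsShift X ∧ ∃ x ∈ X, X ⊆ deltaClosure (orbit x)

/-- A shift is minimal when its only subsystem is itself. -/
def IsMinimalShift {d : ℕ} (X : Set (Config d)) : Prop :=
  IsShift X ∧ ∀ Z, IsSubsystem Z X → Z = X

/-- The Cantor–Bendixson derivatives of the space `S^d` of `d`-dimensional shifts. -/
def CBderiv (d : ℕ) : ℕ → Set (Set (Config d))
  | 0 => {X : Set (Config d) | IsShift X}
  | n + 1 => {X : Set (Config d) | X ∈ CBderiv d n ∧ ¬ IsolatedIn (CBderiv d n) X}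

/-! ### Semigroups generated by two multiplicatively independent integers -/

lemma semi_aux (α β ε : ℝ) (hβ : 0 < β) (m n : ℕ)
    (h0 : 0 < m * α - n * β) (h1 : m * α - n * β < ε) :
    ∃ M : ℝ, ∀ t ≥ M, ∃ a b : ℕ, t ≤ a * α + b * β ∧ a * α + b * β < t + ε := by
  set δ := m * α - n * β with hδ
  set J := ⌈β / δ⌉₊ with hJ
  refine ⟨J * n * β + β, fun t ht => ?_⟩
  have hJn : (0:ℝ) ≤ J * n * β := by positivity
  have ht0 : 0 ≤ t := by linarith
  set l := ⌊t / β⌋₊ with hl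
  have hl1 : l * β ≤ t := by
    have := Nat.floor_le (show 0 ≤ t / β by positivity)
    rwa [le_div_iff₀ hβ] at this
  have hl2 : t < (l + 1) * β := by
    have := Nat.lt_floor_add_one (t / β)
    rwa [div_lt_iff₀ hβ] at this
  have hlJ : J * n ≤ l := by
    have h : ((J * n : ℕ) : ℝ) * β ≤ l * β := by push_cast; nlinarith
    exact_mod_cast le_of_mul_le_mul_right h hβ
  set j := ⌈(t - l * β) / δ⌉₊ with hj
  have hj0 : 0 ≤ (t - l * β) / δ := div_nonneg (by linarith) h0.le
  have hj1 : t - l * β ≤ j * δ := by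
    have := Nat.le_ceil ((t - l * β) / δ)
    rwa [div_le_iff₀ h0] at this
  have hj2 : j * δ < t - l * β + δ := by
    have := Nat.ceil_lt_add_one hj0
    have h := mul_lt_mul_of_pos_right this h0
    rw [add_mul, div_mul_cancel₀ _ h0.ne'] at h
    linarith
  have hjJ : j ≤ J := by
    apply Nat.ceil_le_ceil
    gcongr
    linarith
  have hjn : j * n ≤ l := (Nat.mul_le_mul_right n hjJ).trans hlJ
  refine ⟨j * m, l - j * n, ?_⟩
  have e : ((j * m : ℕ) : ℝ) * α + ((l - j * n : ℕ) : ℝ) * β = l * β + j * δ := by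
    rw [Nat.cast_sub hjn, hδ]; push_cast; ring
  rw [e]
  constructor <;> linarith

lemma semi (α β ε : ℝ) (hα : 0 < α) (hβ : 0 < β) (hε : 0 < ε) (h : Irrational (α / β)) :
    ∃ M : ℝ, ∀ t ≥ M, ∃ a b : ℕ, t ≤ a * α + b * β ∧ a * α + b * β < t + ε := by
  have hd := dense_addSubgroupClosure_pair_iff.2 h
  obtain ⟨z, hz, hz0, hz1⟩ := hd.exists_between (show (0:ℝ) < min ε (min α β) by positivity)
  obtain ⟨m, n, rfl⟩ := AddSubgroup.mem_closure_pair.1 hz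
  simp only [zsmul_eq_mul, lt_min_iff] at hz0 hz1
  obtain ⟨hz1, hz2, hz3⟩ := hz1
  rcases le_or_gt m 0 with hm | hm
  · have hm' : (m:ℝ) ≤ 0 := by exact_mod_cast hm
    rcases le_or_gt n 0 with hn | hn
    · have hn' : (n:ℝ) ≤ 0 := by exact_mod_cast hn
      nlinarith
    · obtain ⟨n', rfl⟩ := Int.eq_ofNat_of_zero_le hn.le
      obtain ⟨m', hm2⟩ := Int.eq_ofNat_of_zero_le (show 0 ≤ -m by omega)
      have e : (m:ℝ) = - (m':ℝ) := by
        have : m = -(m':ℤ) := by omega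
        rw [this]; push_cast; rfl
      rw [e] at hz0 hz1
      push_cast at hz0 hz1
      obtain ⟨M, hM⟩ := semi_aux β α ε hα n' m' (by linarith) (by linarith)
      refine ⟨M, fun t ht => ?_⟩
      obtain ⟨a, b, h1, h2⟩ := hM t ht
      exact ⟨b, a, by linarith, by linarith⟩
  · have hm' : (1:ℝ) ≤ m := by exact_mod_cast hm
    rcases le_or_gt 0 n with hn | hn
    · have hn' : (0:ℝ) ≤ n := by exact_mod_cast hn
      nlinarith
    · obtain ⟨m', rfl⟩ := Int.eq_ofNat_of_zero_le hm.le
      obtain ⟨n', hn2⟩ := Int.eq_ofNat_of_zero_le (show 0 ≤ -n by omega)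
      have e : (n:ℝ) = - (n':ℝ) := by
        have : n = -(n':ℤ) := by omega
        rw [this]; push_cast; rfl
      rw [e] at hz0 hz1
      push_cast at hz0 hz1
      exact semi_aux α β ε hβ m' n' (by linarith) (by linarith)

lemma irr_log : Irrational (Real.log 2 / Real.log 3) := by
  rw [irrational_iff_ne_rational]
  intro a b hb h
  have h2 : 0 < Real.log 2 := Real.log_pos (by norm_num)
  have h3 : 0 < Real.log 3 := Real.log_pos (by norm_num)
  have hb' : (b:ℝ) ≠ 0 := by exact_mod_cast hb
  have h4 : (b:ℝ) * Real.log 2 = a * Real.log 3 := by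
    field_simp at h; linarith
  have h5 : (b.natAbs:ℝ) * Real.log 2 = a.natAbs * Real.log 3 := by
    have := congrArg abs h4
    rw [abs_mul, abs_mul, abs_of_pos h2, abs_of_pos h3] at this
    rwa [Nat.cast_natAbs, Nat.cast_natAbs, Int.cast_abs, Int.cast_abs]
  rw [← Real.log_pow, ← Real.log_pow] at h5
  have h6 := Real.log_injOn_pos (Set.mem_Ioi.2 (by positivity)) (Set.mem_Ioi.2 (by positivity)) h5
  have h7 : 2 ^ b.natAbs = 3 ^ a.natAbs := by exact_mod_cast h6
  have h8 : Even (2 ^ b.natAbs) := Even.pow_of_ne_zero (by decide) (by omega)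
  rw [h7] at h8
  have : Odd (3 ^ a.natAbs) := Odd.pow (by decide)
  exact (Nat.not_even_iff_odd.2 this) h8

/-- Multiples of a small positive number by `(2^k)^a (3^k)^b` approximate everything in `[1,2]`. -/
lemma approx_mul (k : ℕ) (hk : 0 < k) (ε : ℝ) (hε : 0 < ε) :
    ∃ η > 0, ∀ r : ℝ, 0 < r → r < η → ∀ Y : ℝ, 1 ≤ Y → Y ≤ 2 →
      ∃ a b : ℕ, |((((2 ^ k) ^ a * (3 ^ k) ^ b : ℕ)) : ℝ) * r - Y| < ε := by
  have h2 : 0 < Real.log 2 := Real.log_pos (by norm_num)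
  have h3 : 0 < Real.log 3 := Real.log_pos (by norm_num)
  have hk' : (0:ℝ) < k := by exact_mod_cast hk
  have hl : 0 < Real.log (1 + ε / 2) := Real.log_pos (by linarith)
  obtain ⟨M, hM⟩ := semi (k * Real.log 2) (k * Real.log 3) (Real.log (1 + ε / 2))
    (by positivity) (by positivity) hl (by
      rw [mul_div_mul_left _ _ hk'.ne']; exact irr_log)
  refine ⟨Real.exp (-M), Real.exp_pos _, fun r hr0 hr Y hY1 hY2 => ?_⟩
  have hlr : Real.log r ≤ -M := by
    have := Real.log_le_log hr0 hr.le
    rwa [Real.log_exp] at this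
  have hlY : 0 ≤ Real.log Y := Real.log_nonneg hY1
  obtain ⟨a, b, h4, h5⟩ := hM (Real.log Y - Real.log r) (by linarith)
  refine ⟨a, b, ?_⟩
  set s : ℝ := ((((2 ^ k) ^ a * (3 ^ k) ^ b : ℕ)) : ℝ) with hs
  have hs0 : 0 < s := by rw [hs]; positivity
  have hls : Real.log s = a * (k * Real.log 2) + b * (k * Real.log 3) := by
    rw [hs]; push_cast
    rw [Real.log_mul (by positivity) (by positivity), Real.log_pow, Real.log_pow, Real.log_pow,
      Real.log_pow]
  have hY0 : 0 < Y := by linarith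
  have h6 : Y ≤ s * r := by
    rw [← Real.log_le_log_iff hY0 (by positivity), Real.log_mul hs0.ne' hr0.ne', hls]
    linarith
  have h7 : s * r < Y * (1 + ε / 2) := by
    rw [← Real.log_lt_log_iff (by positivity) (by positivity), Real.log_mul hs0.ne' hr0.ne', hls,
      Real.log_mul hY0.ne' (by positivity)]
    linarith
  rw [abs_lt]
  constructor <;> nlinarith

/-! ### The Furstenberg theorem on closed sets invariant under multiplication by 2 and 3 -/

lemma circle_norm_le (x : ℝ) : ‖(x : UnitAddCircle)‖ ≤ |x| := by
  rw [UnitAddCircle.norm_eq]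
  simpa using round_le x 0

lemma circle_rep (x : UnitAddCircle) : ∃ r : ℝ, (r : UnitAddCircle) = x ∧ |r| = ‖x‖ := by
  obtain ⟨y, rfl⟩ := QuotientAddGroup.mk_surjective x
  refine ⟨y - round y, ?_, ?_⟩
  · have : ((round y : ℝ) : UnitAddCircle) = 0 := by
      rw [AddCircle.coe_eq_zero_iff]
      exact ⟨round y, by simp⟩
    change ((y - round y : ℝ) : UnitAddCircle) = (y : UnitAddCircle)
    rw [AddCircle.coe_sub, this, sub_zero]
  · exact (UnitAddCircle.norm_eq).symm

lemma circle_rep' (x : UnitAddCircle) : ∃ r : ℝ, (r : UnitAddCircle) = x ∧ 1 ≤ r ∧ r ≤ 2 := by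
  obtain ⟨y, rfl⟩ := QuotientAddGroup.mk_surjective x
  refine ⟨Int.fract y + 1, ?_, by linarith [Int.fract_nonneg y], by linarith [Int.fract_lt_one y]⟩
  rw [← sub_eq_zero, ← AddCircle.coe_sub, AddCircle.coe_eq_zero_iff]
  refine ⟨1 - ⌊y⌋, ?_⟩
  have h := Int.floor_add_fract y
  simp only [zsmul_eq_mul, mul_one]
  push_cast
  linarith

lemma circ_pow_mem {B : Set UnitAddCircle} {p : ℕ} (h : ∀ x ∈ B, p • x ∈ B) (a : ℕ) :
    ∀ x ∈ B, p ^ a • x ∈ B := by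
  induction a with
  | zero => intro x hx; simpa using hx
  | succ n ih => intro x hx; rw [pow_succ', mul_smul]; exact h _ (ih x hx)

lemma univ_of_acc_zero {B : Set UnitAddCircle} (hB : IsClosed B) (k : ℕ) (hk : 0 < k)
    (h2 : ∀ x ∈ B, (2 ^ k) • x ∈ B) (h3 : ∀ x ∈ B, (3 ^ k) • x ∈ B)
    (h0 : ∀ ε : ℝ, 0 < ε → ∃ x ∈ B, x ≠ 0 ∧ ‖x‖ < ε) : B = Set.univ := by
  rw [Set.eq_univ_iff_forall]
  intro y
  rw [← hB.closure_eq, Metric.mem_closure_iff]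
  intro ε hε
  obtain ⟨η, hη, hh⟩ := approx_mul k hk ε hε
  obtain ⟨x, hx, hx0, hxη⟩ := h0 η hη
  obtain ⟨r, rfl, hr⟩ := circle_rep x
  have hr0 : r ≠ 0 := by rintro rfl; exact hx0 (by simp)
  have hmem : ∀ a b : ℕ, ((2 ^ k) ^ a * (3 ^ k) ^ b) • (r : UnitAddCircle) ∈ B := by
    intro a b
    rw [mul_smul]
    exact circ_pow_mem h2 a _ (circ_pow_mem h3 b _ hx)
  rcases lt_or_gt_of_ne hr0 with hneg | hpos
  · obtain ⟨Y, hY, hY1, hY2⟩ := circle_rep' (-y)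
    rw [← hr, abs_of_neg hneg] at hxη
    obtain ⟨a, b, hab⟩ := hh (-r) (by linarith) hxη Y hY1 hY2
    refine ⟨_, hmem a b, ?_⟩
    rw [dist_eq_norm]
    have : y = ((-Y : ℝ) : UnitAddCircle) := by rw [AddCircle.coe_neg, hY, neg_neg]
    rw [this, ← AddCircle.coe_nsmul, ← AddCircle.coe_sub]
    refine (circle_norm_le _).trans_lt ?_
    rw [nsmul_eq_mul]
    have e : ∀ s : ℝ, -Y - s * r = s * -r - Y := fun s => by ring
    rw [e]
    exact hab
  · obtain ⟨Y, hY, hY1, hY2⟩ := circle_rep' y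
    rw [← hr, abs_of_pos hpos] at hxη
    obtain ⟨a, b, hab⟩ := hh r hpos hxη Y hY1 hY2
    refine ⟨_, hmem a b, ?_⟩
    rw [dist_comm, dist_eq_norm, ← hY, ← AddCircle.coe_nsmul, ← AddCircle.coe_sub]
    refine (circle_norm_le _).trans_lt ?_
    rwa [nsmul_eq_mul]

lemma nsmul_fix {q k : ℕ} {x : UnitAddCircle} (hq : q • x = 0) (h : k ≡ 1 [MOD q]) :
    k • x = x := by
  have h1 : ((addOrderOf x) : ℕ) ∣ q := addOrderOf_dvd_of_nsmul_eq_zero hq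
  have := (nsmul_eq_nsmul_iff_modEq (x := x) (n := k) (m := 1)).2 (h.of_dvd h1)
  simpa using this

lemma acc_inv {A : Set UnitAddCircle} {p : ℕ} (hp : 0 < p) (h : ∀ x ∈ A, p • x ∈ A) :
    ∀ x ∈ derivedSet A, p • x ∈ derivedSet A := by
  intro x hx
  rw [mem_derivedSet, accPt_iff_nhds] at hx ⊢
  intro U hU
  have hc : Continuous (fun z : UnitAddCircle => p • z) := continuous_nsmul p
  have hV := hc.continuousAt.preimage_mem_nhds hU
  have hp' : (0:ℝ) < p := by exact_mod_cast hp
  have hb : Metric.ball x (1 / (2 * p)) ∈ nhds x := Metric.ball_mem_nhds _ (by positivity)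
  obtain ⟨y, ⟨⟨hy1, hy2⟩, hyA⟩, hne⟩ := hx _ (Filter.inter_mem hV hb)
  refine ⟨p • y, ⟨hy1, h y hyA⟩, fun he => hne ?_⟩
  obtain ⟨r, hr, hr'⟩ := circle_rep (y - x)
  rw [Metric.mem_ball, dist_eq_norm, ← hr', lt_div_iff₀ (by positivity)] at hy2
  have h1 : p • (y - x) = 0 := by rw [smul_sub, he, sub_self]
  rw [← hr, ← AddCircle.coe_nsmul, AddCircle.coe_eq_zero_iff] at h1
  obtain ⟨n, hn⟩ := h1
  simp only [zsmul_eq_mul, mul_one, nsmul_eq_mul] at hn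
  have h2 : |(n:ℝ)| < 1 := by
    rw [hn, abs_mul, abs_of_pos hp']
    nlinarith [abs_nonneg r]
  have h3 : n = 0 := by
    rw [← Int.abs_lt_one_iff]; exact_mod_cast h2
  rw [h3, Int.cast_zero] at hn
  have h4 : r = 0 := by
    rcases mul_eq_zero.1 hn.symm with h | h
    · exact absurd h hp'.ne'
    · exact_mod_cast h
  rw [h4] at hr
  exact sub_eq_zero.1 (by rw [← hr]; simp)

lemma univ_of_acc_torsion {A : Set UnitAddCircle} (hA : IsClosed A)
    (h2 : ∀ x ∈ A, 2 • x ∈ A) (h3 : ∀ x ∈ A, 3 • x ∈ A)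
    (x : UnitAddCircle) (hx : x ∈ derivedSet A) (ht : IsOfFinAddOrder x) : A = Set.univ := by
  have h6 : ∀ x ∈ A, 6 • x ∈ A := fun x hx => by
    have := h2 _ (h3 x hx)
    rwa [← mul_smul] at this
  have hni : ¬ Function.Injective (fun i : ℕ => 6 ^ i • x) := by
    intro hinj
    have hfin := ht.finite_multiples
    have : (Set.range fun i : ℕ => 6 ^ i • x).Infinite := Set.infinite_range_of_injective hinj
    apply this
    apply hfin.subset
    rintro _ ⟨i, rfl⟩
    exact ⟨6 ^ i, rfl⟩
  have : ∃ i p : ℕ, 0 < p ∧ 6 ^ (i + p) • x = 6 ^ i • x := by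
    simp only [Function.Injective] at hni
    push Not at hni
    obtain ⟨a, b, hab, hne⟩ := hni
    rcases lt_or_gt_of_ne hne with h | h
    · exact ⟨a, b - a, by omega, by rw [Nat.add_sub_cancel' h.le]; exact hab.symm⟩
    · exact ⟨b, a - b, by omega, by rw [Nat.add_sub_cancel' h.le]; exact hab⟩
  obtain ⟨i, p, hp, hip⟩ := this
  set y := 6 ^ i • x with hy
  have hyA : y ∈ derivedSet A := circ_pow_mem (acc_inv (by norm_num) h6) i x hx
  set q := 6 ^ p - 1 with hq
  have h6p : 6 ^ p = q + 1 := by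
    have : 0 < 6 ^ p := by positivity
    omega
  have hqy : q • y = 0 := by
    have e : 6 ^ p • y = y := by rw [hy, ← mul_smul, ← pow_add, add_comm]; exact hip
    rw [h6p, add_smul, one_smul] at e
    simpa using e
  have hc6 : Nat.Coprime (6 ^ p) q := by rw [h6p]; simp
  have hc : Nat.Coprime 6 q := Nat.Coprime.coprime_dvd_left (dvd_pow_self 6 hp.ne') hc6
  have hc2 : Nat.Coprime 2 q := Nat.Coprime.coprime_dvd_left (by norm_num) hc
  have hc3 : Nat.Coprime 3 q := Nat.Coprime.coprime_dvd_left (by norm_num) hc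
  have hq0 : 0 < q := by
    have : 6 ^ 1 ≤ 6 ^ p := Nat.pow_le_pow_right (by norm_num) hp
    omega
  have f2 := nsmul_fix hqy (Nat.ModEq.pow_totient hc2)
  have f3 := nsmul_fix hqy (Nat.ModEq.pow_totient hc3)
  have hB : (fun z => z + y) ⁻¹' A = Set.univ := by
    apply univ_of_acc_zero (hA.preimage (by fun_prop)) q.totient (Nat.totient_pos.2 hq0)
    · intro z hz
      have := circ_pow_mem h2 q.totient _ hz
      simpa only [Set.mem_preimage, smul_add, f2] using this
    · intro z hz
      have := circ_pow_mem h3 q.totient _ hz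
      simpa only [Set.mem_preimage, smul_add, f3] using this
    · intro ε hε
      rw [mem_derivedSet, accPt_iff_nhds] at hyA
      obtain ⟨z, ⟨hz1, hz2⟩, hz3⟩ := hyA _ (Metric.ball_mem_nhds y hε)
      refine ⟨z - y, by simpa using hz2, sub_ne_zero.2 hz3, ?_⟩
      rwa [← dist_eq_norm]
  rw [Set.eq_univ_iff_forall] at hB ⊢
  intro z
  simpa using hB (z - y)

lemma diff_univ {C : Set UnitAddCircle} (hC : IsClosed C) (hne : C.Nonempty)
    (htf : ∀ x ∈ C, ¬ IsOfFinAddOrder x) (k : ℕ) (hk : 0 < k)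
    (h2 : ∀ x ∈ C, (2 ^ k) • x ∈ C) (h3 : ∀ x ∈ C, (3 ^ k) • x ∈ C) (w : UnitAddCircle) :
    ∃ x ∈ C, x + w ∈ C := by
  have hD : (fun z : UnitAddCircle × UnitAddCircle => z.2 - z.1) '' (C ×ˢ C) = Set.univ := by
    apply univ_of_acc_zero _ k hk
    · rintro _ ⟨⟨x, y⟩, ⟨hx, hy⟩, rfl⟩
      exact ⟨(2 ^ k • x, 2 ^ k • y), ⟨h2 x hx, h2 y hy⟩, by simp [smul_sub]⟩
    · rintro _ ⟨⟨x, y⟩, ⟨hx, hy⟩, rfl⟩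
      exact ⟨(3 ^ k • x, 3 ^ k • y), ⟨h3 x hx, h3 y hy⟩, by simp [smul_sub]⟩
    · intro ε hε
      have hinf : C.Infinite := by
        obtain ⟨x, hx⟩ := hne
        have hi := injective_nsmul_iff_not_isOfFinAddOrder.2 (htf x hx)
        apply Set.infinite_of_injective_forall_mem (f := fun n : ℕ => ((2 ^ k) ^ n) • x)
        · intro a b hab
          have h := hi hab
          have h1 : 1 < 2 ^ k := Nat.one_lt_two_pow hk.ne'
          exact Nat.pow_right_injective h1 h
        · intro n; exact circ_pow_mem h2 n x hx
      obtain ⟨z, -, hz⟩ := hinf.exists_accPt_of_subset_isCompact isCompact_univ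
        (Set.subset_univ _)
      rw [accPt_iff_nhds] at hz
      obtain ⟨a, ⟨ha1, ha2⟩, ha3⟩ := hz _ (Metric.ball_mem_nhds z (half_pos hε))
      obtain ⟨b, ⟨hb1, hb2⟩, hb3⟩ := hz _ (Metric.ball_mem_nhds z
        (lt_min (half_pos hε) (dist_pos.2 ha3)))
      rw [Metric.mem_ball] at ha1 hb1
      rw [lt_min_iff] at hb1
      refine ⟨b - a, ⟨(a, b), ⟨ha2, hb2⟩, rfl⟩, ?_, ?_⟩
      · intro h
        rw [sub_eq_zero.1 h] at hb1
        exact lt_irrefl _ hb1.2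
      · rw [← dist_eq_norm]
        have := dist_triangle_right b a z
        linarith [hb1.1]
    · exact ((hC.isCompact.prod hC.isCompact).image (by fun_prop)).isClosed
  have : w ∈ (Set.univ : Set UnitAddCircle) := trivial
  rw [← hD] at this
  obtain ⟨⟨x, y⟩, ⟨hx, hy⟩, h⟩ := this
  refine ⟨x, hx, ?_⟩
  rw [← h]
  simpa using hy

lemma no_torsion_free {M : Set UnitAddCircle} (hM : IsClosed M) (hne : M.Nonempty)
    (h2 : ∀ x ∈ M, 2 • x ∈ M) (h3 : ∀ x ∈ M, 3 • x ∈ M) :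
    ∃ x ∈ M, IsOfFinAddOrder x := by
  by_contra! htf
  have key : ∀ p : ℕ, ∃ x : UnitAddCircle, ∀ i : ℕ, i ≤ 6 * p + 1 →
      x + i • (((1 / (6 * p + 1 : ℕ) : ℝ)) : UnitAddCircle) ∈ M := by
    intro p
    set q := 6 * p + 1 with hq
    set w : UnitAddCircle := (((1 / (q : ℕ) : ℝ)) : UnitAddCircle) with hw
    have hqw : q • w = 0 := by
      rw [hw, ← AddCircle.coe_nsmul, AddCircle.coe_eq_zero_iff]
      refine ⟨1, ?_⟩
      have : (q:ℝ) ≠ 0 := by rw [hq]; positivity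
      simp [this]
    have hc : Nat.Coprime 6 q := by rw [hq]; simp
    have hc2 : Nat.Coprime 2 q := Nat.Coprime.coprime_dvd_left (by norm_num) hc
    have hc3 : Nat.Coprime 3 q := Nat.Coprime.coprime_dvd_left (by norm_num) hc
    have f2 := nsmul_fix hqw (Nat.ModEq.pow_totient hc2)
    have f3 := nsmul_fix hqw (Nat.ModEq.pow_totient hc3)
    have hk : 0 < q.totient := Nat.totient_pos.2 (by omega)
    have step : ∀ j : ℕ, ∃ C : Set UnitAddCircle, IsClosed C ∧ C.Nonempty ∧
        (∀ x ∈ C, (2 ^ q.totient) • x ∈ C) ∧ (∀ x ∈ C, (3 ^ q.totient) • x ∈ C) ∧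
        ∀ x ∈ C, ∀ i ≤ j, x + i • w ∈ M := by
      intro j
      induction j with
      | zero =>
        refine ⟨M, hM, hne, circ_pow_mem h2 _, circ_pow_mem h3 _, ?_⟩
        intro x hx i hi
        obtain rfl : i = 0 := by omega
        simpa using hx
      | succ j ih =>
        obtain ⟨C, hC, hCne, c2, c3, hC'⟩ := ih
        have hCM : ∀ x ∈ C, x ∈ M := fun x hx => by simpa using hC' x hx 0 (Nat.zero_le _)
        refine ⟨C ∩ (fun x => x + w) ⁻¹' C, hC.inter (hC.preimage (by fun_prop)), ?_, ?_, ?_, ?_⟩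
        · obtain ⟨x, hx, hx'⟩ := diff_univ hC hCne (fun x hx => htf x (hCM x hx)) _ hk c2 c3 w
          exact ⟨x, hx, hx'⟩
        · rintro x ⟨hx, hx'⟩
          refine ⟨c2 x hx, ?_⟩
          have := c2 _ hx'
          simpa only [Set.mem_preimage, smul_add, f2] using this
        · rintro x ⟨hx, hx'⟩
          refine ⟨c3 x hx, ?_⟩
          have := c3 _ hx'
          simpa only [Set.mem_preimage, smul_add, f3] using this
        · rintro x ⟨hx, hx'⟩ i hi
          rcases Nat.eq_zero_or_pos i with rfl | hi0
          · exact hC' x hx 0 (Nat.zero_le _)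
          · obtain ⟨i, rfl⟩ : ∃ i', i = i' + 1 := ⟨i - 1, by omega⟩
            have := hC' _ hx' i (by omega)
            rw [add_smul, one_smul, add_comm (i • w), ← add_assoc]
            exact this
    obtain ⟨C, -, ⟨x, hx⟩, -, -, h⟩ := step q
    exact ⟨x, h x hx⟩
  have h0 : (0 : UnitAddCircle) ∈ M := by
    rw [← hM.closure_eq, Metric.mem_closure_iff]
    intro ε hε
    obtain ⟨p, hp⟩ := exists_nat_gt (1 / ε)
    obtain ⟨x, hx⟩ := key p
    have hp0 : (0:ℝ) < p := lt_trans (by positivity) hp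
    obtain ⟨r, hr, hr1, hr2⟩ := circle_rep' (-x)
    set q := 6 * p + 1 with hq
    have hq0 : (0:ℝ) < q := by rw [hq]; positivity
    have hqp : (p:ℝ) < q := by
      have : p < q := by omega
      exact_mod_cast this
    -- use the representative `r - 1 ∈ [0,1]` of `-x`
    set i := ⌊(r - 1) * q⌋₊ with hi
    have hi1 : (i:ℝ) ≤ (r - 1) * q := Nat.floor_le (mul_nonneg (by linarith) hq0.le)
    have hi2 : (r - 1) * q < i + 1 := Nat.lt_floor_add_one _
    refine ⟨_, hx i ?_, ?_⟩
    · have : (i:ℝ) ≤ q := by nlinarith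
      exact_mod_cast this
    · rw [dist_comm, dist_zero_right]
      have e1 : x = ((-(r-1) : ℝ) : UnitAddCircle) := by
        rw [neg_sub, sub_eq_add_neg, AddCircle.coe_add, AddCircle.coe_neg, hr, neg_neg]
        have : ((1:ℝ) : UnitAddCircle) = 0 := AddCircle.coe_period 1
        rw [this, zero_add]
      rw [e1, ← AddCircle.coe_nsmul, ← AddCircle.coe_add]
      refine (circle_norm_le _).trans_lt ?_
      rw [nsmul_eq_mul]
      have e2 : -(r - 1) + (i:ℝ) * (1 / (q:ℝ)) = (i - (r - 1) * q) / q := by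
        field_simp; ring
      rw [e2, abs_div, abs_of_pos hq0, div_lt_iff₀ hq0, abs_lt]
      have h5 : 1 < p * ε := by rwa [div_lt_iff₀ hε] at hp
      have : 1 < ε * q := by nlinarith
      constructor <;> linarith
  exact htf 0 h0 IsOfFinAddOrder.zero

theorem furstenberg {A : Set UnitAddCircle} (hA : IsClosed A)
    (h2 : ∀ x ∈ A, 2 • x ∈ A) (h3 : ∀ x ∈ A, 3 • x ∈ A) : A.Finite ∨ A = Set.univ := by
  by_cases hf : A.Finite
  · exact Or.inl hf
  right
  obtain ⟨z, -, hz⟩ := Set.Infinite.exists_accPt_of_subset_isCompact hf isCompact_univ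
    (Set.subset_univ _)
  obtain ⟨x, hx, hxt⟩ := no_torsion_free (isClosed_derivedSet A) ⟨z, hz⟩
    (acc_inv (by norm_num) h2) (acc_inv (by norm_num) h3)
  exact univ_of_acc_torsion hA h2 h3 x hx hxt

/-! ### The metric -/

/-- Two configurations agree on the ball of radius `m`. -/
def Agree {d : ℕ} (m : ℕ) (x y : Config d) : Prop := ∀ v, normInf v ≤ m → x v = y v

lemma Agree.symm {d m : ℕ} {x y : Config d} (h : Agree m x y) : Agree m y x :=
  fun v hv => (h v hv).symm

lemma Agree.trans {d m : ℕ} {x y z : Config d} (h : Agree m x y) (h' : Agree m y z) :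
    Agree m x z := fun v hv => (h v hv).trans (h' v hv)

lemma Agree.mono {d m n : ℕ} {x y : Config d} (h : Agree n x y) (hmn : m ≤ n) : Agree m x y :=
  fun v hv => h v (hv.trans hmn)

lemma normInf_le {d : ℕ} {v : ZD d} {m : ℕ} : normInf v ≤ m ↔ ∀ i, (v i).natAbs ≤ m := by
  simp [normInf]

lemma deltaDist_lt {d m : ℕ} {x y : Config d} :
    deltaDist x y < (2:ℝ) ^ (-(m:ℤ)) ↔ Agree m x y := by
  unfold deltaDist
  split_ifs with h
  · subst h
    simp only [Agree, implies_true, iff_true]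
    positivity
  · set s := {k : ℕ | ∃ n : ZD d, normInf n = k ∧ x n ≠ y n} with hs
    have hne : s.Nonempty := by
      obtain ⟨n, hn⟩ := Function.ne_iff.1 h
      exact ⟨_, n, rfl, hn⟩
    rw [zpow_lt_zpow_iff_right₀ (by norm_num)]
    constructor
    · intro h1 v hv
      by_contra h2
      have : sInf s ≤ normInf v := Nat.sInf_le ⟨v, rfl, h2⟩
      omega
    · intro h1
      obtain ⟨n, hn, hn'⟩ := Nat.sInf_mem hne
      by_contra h2
      exact hn' (h1 n (by omega))

lemma deltaDist_nonneg {d : ℕ} (x y : Config d) : 0 ≤ deltaDist x y := by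
  unfold deltaDist; split_ifs <;> positivity

lemma deltaDist_le_one {d : ℕ} (x y : Config d) : deltaDist x y ≤ 1 := by
  unfold deltaDist; split_ifs
  · norm_num
  · apply zpow_le_one_of_nonpos₀ (by norm_num) (by omega)

lemma exists_two_pow_lt {ε : ℝ} (hε : 0 < ε) : ∃ m : ℕ, (2:ℝ) ^ (-(m:ℤ)) < ε := by
  obtain ⟨m, hm⟩ := exists_pow_lt_of_lt_one hε (show (1/2:ℝ) < 1 by norm_num)
  refine ⟨m, ?_⟩
  rw [zpow_neg, zpow_natCast]
  simpa using hm

lemma deltaH_lt {d m : ℕ} {X Z : Set (Config d)} (hX : X.Nonempty) (hZ : Z.Nonempty)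
    (h : deltaH X Z < (2:ℝ) ^ (-(m:ℤ))) :
    (∀ x ∈ X, ∃ z ∈ Z, Agree m x z) ∧ (∀ z ∈ Z, ∃ x ∈ X, Agree m x z) := by
  have := hX.to_subtype
  have := hZ.to_subtype
  obtain ⟨h1, h2⟩ := max_lt_iff.1 h
  constructor
  · intro x hx
    have hb : BddAbove (Set.range fun x : X => ⨅ z : Z, deltaDist (x : Config d) (z : Config d)) := by
      refine ⟨1, ?_⟩
      rintro _ ⟨x, rfl⟩
      exact (ciInf_le ⟨0, by rintro _ ⟨z, rfl⟩; exact deltaDist_nonneg _ _⟩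
        (Classical.arbitrary Z)).trans (deltaDist_le_one _ _)
    have h3 := (le_ciSup hb ⟨x, hx⟩).trans_lt h1
    obtain ⟨⟨z, hz⟩, h4⟩ := exists_lt_of_ciInf_lt h3
    exact ⟨z, hz, deltaDist_lt.1 h4⟩
  · intro z hz
    have hb : BddAbove (Set.range fun z : Z => ⨅ x : X, deltaDist (x : Config d) (z : Config d)) := by
      refine ⟨1, ?_⟩
      rintro _ ⟨x, rfl⟩
      exact (ciInf_le ⟨0, by rintro _ ⟨z, rfl⟩; exact deltaDist_nonneg _ _⟩
        (Classical.arbitrary X)).trans (deltaDist_le_one _ _)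
    have h3 := (le_ciSup hb ⟨z, hz⟩).trans_lt h2
    obtain ⟨⟨x, hx⟩, h4⟩ := exists_lt_of_ciInf_lt h3
    exact ⟨x, hx, deltaDist_lt.1 h4⟩

lemma deltaH_le {d m : ℕ} {X Z : Set (Config d)} (hX : X.Nonempty) (hZ : Z.Nonempty)
    (h1 : ∀ x ∈ X, ∃ z ∈ Z, Agree m x z) (h2 : ∀ z ∈ Z, ∃ x ∈ X, Agree m x z) :
    deltaH X Z ≤ (2:ℝ) ^ (-(m:ℤ)) := by
  have := hX.to_subtype
  have := hZ.to_subtype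
  apply max_le
  · apply ciSup_le
    rintro ⟨x, hx⟩
    obtain ⟨z, hz, h⟩ := h1 x hx
    exact (ciInf_le ⟨0, by rintro _ ⟨z, rfl⟩; exact deltaDist_nonneg _ _⟩ ⟨z, hz⟩).trans
      (deltaDist_lt.2 h).le
  · apply ciSup_le
    rintro ⟨z, hz⟩
    obtain ⟨x, hx, h⟩ := h2 z hz
    exact (ciInf_le ⟨0, by rintro _ ⟨z, rfl⟩; exact deltaDist_nonneg _ _⟩
      (⟨x, hx⟩ : X)).trans (deltaDist_lt.2 h).le

lemma closed_iff {d : ℕ} {A : Set (Config d)} :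
    IsDeltaClosed A ↔ ∀ x, (∀ m, ∃ a ∈ A, Agree m x a) → x ∈ A := by
  constructor
  · intro h x hx
    apply h
    intro ε hε
    obtain ⟨m, hm⟩ := exists_two_pow_lt hε
    obtain ⟨a, ha, hxa⟩ := hx m
    exact ⟨a, ha, (deltaDist_lt.2 hxa).trans hm⟩
  · intro h x hx
    apply h
    intro m
    obtain ⟨a, ha, hxa⟩ := hx ((2:ℝ) ^ (-(m:ℤ))) (by positivity)
    exact ⟨a, ha, deltaDist_lt.1 hxa⟩

lemma isClosed_of_deltaClosed {d : ℕ} {A : Set (Config d)} (h : IsDeltaClosed A) : IsClosed A := by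
  rw [← closure_subset_iff_isClosed]
  intro x hx
  refine closed_iff.1 h x fun m => ?_
  have hf : {v : ZD d | normInf v ≤ m}.Finite := by
    apply (Set.finite_Icc (fun _ : Fin d => -(m:ℤ)) (fun _ => (m:ℤ))).subset
    intro v hv
    have hv' := normInf_le.1 hv
    constructor <;> intro i <;> have := hv' i <;> simp only <;> omega
  have ho : IsOpen (Set.pi {v : ZD d | normInf v ≤ m} fun v => ({x v} : Set ℤ)) :=
    isOpen_set_pi hf (fun _ _ => isOpen_discrete _)
  obtain ⟨a, ha, haA⟩ := mem_closure_iff.1 hx _ ho (fun v _ => rfl)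
  exact ⟨a, haA, fun v hv => (ha v hv).symm⟩

/-! ### Translations in the lattice -/

/-- The `j`-th basis vector. -/
def ee {d : ℕ} (j : Fin d) : ZD d := Pi.single j 1

lemma ee_norm {d : ℕ} (j : Fin d) : normInf (ee j) ≤ 1 := by
  rw [normInf_le]
  intro i
  by_cases h : i = j
  · subst h; simp [ee]
  · simp [ee, h]

lemma normInf_zero' {d m : ℕ} : normInf (0 : ZD d) ≤ m := by
  rw [normInf_le]; intro i; simp

lemma normInf_add {d m : ℕ} {u v : ZD d} (hu : normInf u ≤ 1) (hv : normInf v ≤ m) :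
    normInf (u + v) ≤ m + 1 := by
  rw [normInf_le] at *
  intro i
  have h1 := hu i
  have h2 := hv i
  rw [Pi.add_apply]
  omega

lemma periods {d : ℕ} {α : Type*} (f : ZD d → α) (J : Fin d → Prop)
    (h : ∀ j, J j → ∀ u, f (u + ee j) = f u) (u : ZD d) (hu : ∀ j, ¬ J j → u j = 0) (v : ZD d) :
    f (v + u) = f v := by
  let H : AddSubgroup (ZD d) :=
    { carrier := {u | ∀ v, f (v + u) = f v}
      zero_mem' := fun v => by rw [add_zero]
      add_mem' := fun {a b} ha hb v => by rw [← add_assoc, hb, ha]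
      neg_mem' := fun {a} ha v => by rw [← ha, neg_add_cancel_right] }
  have hu' : u = ∑ j, u j • ee j := by
    ext i
    simp [ee, Finset.sum_apply, Pi.single_apply]
  have : u ∈ H := by
    rw [hu']
    apply AddSubgroup.sum_mem
    intro j _
    by_cases hj : J j
    · exact AddSubgroup.zsmul_mem _ (show ee j ∈ H from h j hj) _
    · rw [hu j hj, zero_smul]; exact H.zero_mem
  exact this v

lemma const_of_steps {d : ℕ} {α : Type*} (f : ZD d → α)
    (h : ∀ j u, f (u + ee j) = f u) (u : ZD d) : f u = f 0 := by
  have := periods f (fun _ => True) (fun j _ => h j) u (fun j hj => absurd trivial hj) 0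
  rwa [zero_add] at this

lemma shiftMap_add {d : ℕ} (u v : ZD d) (x : Config d) :
    shiftMap u (shiftMap v x) = shiftMap (v + u) x := by
  ext w; simp [shiftMap, add_assoc]

lemma shiftMap_zero {d : ℕ} (x : Config d) : shiftMap 0 x = x := by
  ext w; simp [shiftMap]

/-- A finite shift-invariant set is isolated. -/
lemma finite_isolated {d : ℕ} (E : Set (Config d)) (hE : E.Finite)
    (hs : ∀ u : ZD d, ∀ x ∈ E, shiftMap u x ∈ E) :
    ∃ m : ℕ, ∀ W : Set (Config d), (∀ u : ZD d, ∀ x ∈ W, shiftMap u x ∈ W) →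
      (∀ w ∈ W, ∃ z ∈ E, Agree m w z) → (∀ z ∈ E, ∃ w ∈ W, Agree m w z) → W = E := by
  classical
  have hR : ∃ R, ∀ x ∈ E, ∀ y ∈ E, Agree R x y → x = y := by
    have : ∀ p : Config d × Config d, ∃ R, Agree R p.1 p.2 → p.1 = p.2 := by
      intro p
      by_cases h : p.1 = p.2
      · exact ⟨0, fun _ => h⟩
      · obtain ⟨n, hn⟩ := Function.ne_iff.1 h
        exact ⟨normInf n, fun h' => absurd (h' n le_rfl) hn⟩
    choose f hf using this
    refine ⟨(hE.toFinset ×ˢ hE.toFinset).sup f, fun x hx y hy h => hf (x, y) (h.mono ?_)⟩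
    apply Finset.le_sup (f := f)
    simp [hx, hy]
  obtain ⟨R, hR⟩ := hR
  refine ⟨R + 1, fun W hW h1 h2 => ?_⟩
  have hsub : ∀ w ∈ W, w ∈ E := by
    intro w hw
    choose z hzE hz using fun u => h1 (shiftMap u w) (hW u w hw)
    have hstep : ∀ j u, shiftMap (-(u + ee j)) (z (u + ee j)) = shiftMap (-u) (z u) := by
      intro j u
      have e : z (u + ee j) = shiftMap (ee j) (z u) := by
        apply hR _ (hzE _) _ (hs _ _ (hzE _))
        intro v hv
        have a1 := hz (u + ee j) v (by omega)
        have a2 := hz u (ee j + v) (normInf_add (ee_norm j) hv)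
        rw [← a1]
        simp only [shiftMap] at a2 ⊢
        rw [← a2, add_assoc]
      rw [e, shiftMap_add]
      congr 1
      abel
    have hc := const_of_steps (fun u => shiftMap (-u) (z u)) hstep
    have : w = z 0 := by
      ext u
      have a1 := hz u 0 normInf_zero'
      have a2 := congrFun (hc u) u
      simp only [shiftMap, neg_zero, zero_add, neg_add_cancel, add_zero] at a1 a2
      rw [a1, a2]
    rw [this]
    exact hzE 0
  apply Set.Subset.antisymm hsub
  intro z hz
  obtain ⟨w, hw, hwz⟩ := h2 z hz
  rw [← hR w (hsub w hw) z hz (hwz.mono (Nat.le_succ R))]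
  exact hw

/-! ### The shift of base-6 expansions -/

/-- The local rule. -/
def Loc {d : ℕ} (i0 i1 : Fin d) (c : ℤ) (x : Config d) (v : ZD d) : Prop :=
  x v / 6 = c ∧ (∀ j, j ≠ i0 → j ≠ i1 → x (v + ee j) = x v) ∧
    x (v + ee i1) % 6 = 2 * (x v % 3) + (x (v + ee i0) % 6) / 3

/-- Space-time diagrams of multiplication by two in base six, over the alphabet
`{6 c, …, 6 c + 5}`. -/
def XX {d : ℕ} (i0 i1 : Fin d) (c : ℤ) : Set (Config d) := {x | ∀ v, Loc i0 i1 c x v}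

/-- Points of the coordinate plane. -/
def pt {d : ℕ} (i0 i1 : Fin d) (i j : ℤ) : ZD d := i • ee i0 + j • ee i1

section base
variable {d : ℕ} {i0 i1 : Fin d} {c : ℤ}

lemma XX_shift (u : ZD d) {x : Config d} (hx : x ∈ XX i0 i1 c) : shiftMap u x ∈ XX i0 i1 c := by
  intro v
  have := hx (u + v)
  simpa only [Loc, shiftMap, add_assoc] using this

lemma Loc_of_agree {x y : Config d} {v : ZD d} (hy : y ∈ XX i0 i1 c)
    (h : Agree 1 (shiftMap v x) y) : Loc i0 i1 c x v := by
  have h0 := h 0 normInf_zero'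
  have he : ∀ j, x (v + ee j) = y (ee j) := fun j => h (ee j) (ee_norm j)
  simp only [shiftMap, add_zero] at h0
  have := hy 0
  simpa only [Loc, zero_add, he, h0] using this

lemma XX_closed : IsDeltaClosed (XX i0 i1 c) := by
  rw [closed_iff]
  intro x hx v
  obtain ⟨a, ha, hxa⟩ := hx (normInf v + 1)
  apply Loc_of_agree (XX_shift v ha)
  intro w hw
  apply hxa
  rw [add_comm v]
  exact normInf_add hw le_rfl

lemma pt_add_e0 (i j : ℤ) : pt i0 i1 i j + ee i0 = pt i0 i1 (i + 1) j := by
  simp only [pt, add_smul, one_smul]; abel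

lemma pt_add_e1 (i j : ℤ) : pt i0 i1 i j + ee i1 = pt i0 i1 i (j + 1) := by
  simp only [pt, add_smul, one_smul]; abel

lemma pt_add (i j i' j' : ℤ) : pt i0 i1 i j + pt i0 i1 i' j' = pt i0 i1 (i + i') (j + j') := by
  simp only [pt, add_smul]; abel

lemma pt_zero : pt i0 i1 0 0 = 0 := by simp [pt]

lemma XX_rule {x : Config d} (hx : x ∈ XX i0 i1 c) (i j : ℤ) :
    x (pt i0 i1 i (j + 1)) % 6 = 2 * (x (pt i0 i1 i j) % 3) + (x (pt i0 i1 (i + 1) j) % 6) / 3 := by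
  have := (hx (pt i0 i1 i j)).2.2
  rwa [pt_add_e0, pt_add_e1] at this

lemma XX_block {x : Config d} (hx : x ∈ XX i0 i1 c) (v : ZD d) : x v / 6 = c := (hx v).1

lemma XX_proj (h01 : i0 ≠ i1) {x : Config d} (hx : x ∈ XX i0 i1 c) (v : ZD d) :
    x v = x (pt i0 i1 (v i0) (v i1)) := by
  have := periods x (fun j => j ≠ i0 ∧ j ≠ i1) (fun j hj u => (hx u).2.1 j hj.1 hj.2)
    (v - pt i0 i1 (v i0) (v i1)) (by
      intro j hj
      have hj' : j = i0 ∨ j = i1 := by tauto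
      rcases hj' with rfl | rfl
      · simp [pt, ee, h01]
      · simp [pt, ee, h01.symm]) (pt i0 i1 (v i0) (v i1))
  rwa [add_sub_cancel] at this

lemma XX_up {x y : Config d} (hx : x ∈ XX i0 i1 c) (hy : y ∈ XX i0 i1 c) (p q : ℤ) (L : ℕ)
    (h : ∀ i : ℕ, i ≤ L → x (pt i0 i1 (p + i) q) = y (pt i0 i1 (p + i) q)) (k : ℕ) :
    ∀ i : ℕ, i + k ≤ L → x (pt i0 i1 (p + i) (q + k)) = y (pt i0 i1 (p + i) (q + k)) := by
  induction k with
  | zero => intro i hi; simpa using h i (by omega)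
  | succ k ih =>
    intro i hi
    have a1 := ih i (by omega)
    have a2 := ih (i + 1) (by omega)
    have r1 := XX_rule hx (p + i) (q + k)
    have r2 := XX_rule hy (p + i) (q + k)
    have b1 := XX_block hx (pt i0 i1 (p + i) (q + k + 1))
    have b2 := XX_block hy (pt i0 i1 (p + i) (q + k + 1))
    push_cast at a2 ⊢
    rw [← add_assoc] at a2 ⊢
    rw [a1, a2] at r1
    omega

lemma XX_agree (h01 : i0 ≠ i1) {x y : Config d} (hx : x ∈ XX i0 i1 c) (hy : y ∈ XX i0 i1 c) (m : ℕ)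
    (h : ∀ i : ℕ, i ≤ 4 * m → x (pt i0 i1 (-m + i) (-m)) = y (pt i0 i1 (-m + i) (-m))) :
    Agree m x y := by
  intro v hv
  rw [normInf_le] at hv
  have h0 := hv i0
  have h1 := hv i1
  have := XX_up hx hy (-m) (-m) (4 * m) h (v i1 + m).toNat (v i0 + m).toNat (by omega)
  rw [XX_proj h01 hx, XX_proj h01 hy]
  convert this using 3 <;> omega

lemma XX_row (h01 : i0 ≠ i1) {x y : Config d} (hx : x ∈ XX i0 i1 c) (hy : y ∈ XX i0 i1 c)
    (h : ∀ i : ℤ, x (pt i0 i1 i 0) = y (pt i0 i1 i 0)) : x = y := by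
  have up : ∀ (j : ℕ) (i : ℤ), x (pt i0 i1 i j) = y (pt i0 i1 i j) := by
    intro j i
    have := XX_up hx hy i 0 j (fun k _ => h _) j 0 (by omega)
    simpa using this
  have down : ∀ (j : ℕ) (i : ℤ), x (pt i0 i1 i (-j)) = y (pt i0 i1 i (-j)) := by
    intro j
    induction j with
    | zero => intro i; simpa using h i
    | succ j ih =>
      intro i
      have e : -((j + 1 : ℕ) : ℤ) + 1 = -j := by push_cast; ring
      have r1 := XX_rule hx i (-((j + 1 : ℕ) : ℤ))
      have r2 := XX_rule hy i (-((j + 1 : ℕ) : ℤ))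
      have r3 := XX_rule hx (i - 1) (-((j + 1 : ℕ) : ℤ))
      have r4 := XX_rule hy (i - 1) (-((j + 1 : ℕ) : ℤ))
      have b1 := XX_block hx (pt i0 i1 i (-((j + 1 : ℕ) : ℤ)))
      have b2 := XX_block hy (pt i0 i1 i (-((j + 1 : ℕ) : ℤ)))
      rw [e, sub_add_cancel] at r3 r4
      rw [e] at r1 r2
      rw [ih] at r1 r3
      generalize x (pt i0 i1 i (-((j + 1 : ℕ) : ℤ))) = X at *
      generalize y (pt i0 i1 i (-((j + 1 : ℕ) : ℤ))) = Y at *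
      omega
  ext v
  rw [XX_proj h01 hx, XX_proj h01 hy]
  rcases le_total 0 (v i1) with hv | hv
  · obtain ⟨n, hn⟩ := Int.eq_ofNat_of_zero_le hv
    rw [hn]; exact up n _
  · obtain ⟨n, hn⟩ := Int.eq_ofNat_of_zero_le (show 0 ≤ - v i1 by omega)
    have : v i1 = -(n:ℤ) := by omega
    rw [this]; exact down n _

/-- The invertible cellular automaton. -/
def FF : Equiv.Perm (ℤ → ℤ) where
  toFun a i := 6 * (a i / 6) + 2 * (a i % 3) + (a (i + 1) % 6) / 3
  invFun b i := 6 * (b i / 6) + 3 * (b (i - 1) % 2) + (b i % 6) / 2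
  left_inv a := by
    ext i
    simp only [sub_add_cancel]
    omega
  right_inv b := by
    ext i
    simp only [add_sub_cancel_right]
    omega

lemma FF_apply (a : ℤ → ℤ) (i : ℤ) :
    FF a i = 6 * (a i / 6) + 2 * (a i % 3) + (a (i + 1) % 6) / 3 := rfl

lemma FF_symm_apply (a : ℤ → ℤ) (i : ℤ) :
    FF.symm a i = 6 * (a i / 6) + 3 * (a (i - 1) % 2) + (a i % 6) / 2 := rfl

lemma FF_block (a : ℤ → ℤ) (i : ℤ) : FF a i / 6 = a i / 6 := by rw [FF_apply]; omega

lemma FF_zpow_block (a : ℤ → ℤ) (j i : ℤ) : (FF ^ j) a i / 6 = a i / 6 := by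
  induction j using Int.induction_on with
  | zero => simp
  | succ n ih =>
    rw [add_comm, zpow_add, zpow_one, Equiv.Perm.mul_apply, FF_block, ih]
  | pred n ih =>
    rw [← ih]
    have : (FF ^ (-(n:ℤ))) a = FF ((FF ^ (-(n:ℤ) - 1)) a) := by
      rw [← Equiv.Perm.mul_apply, ← zpow_one_add]; congr 2; ring
    rw [this, FF_block]

/-- The space-time diagram with given row `0`. -/
def ofRow (i0 i1 : Fin d) (a : ℤ → ℤ) : Config d := fun v => (FF ^ (v i1)) a (v i0)

lemma ofRow_mem (h01 : i0 ≠ i1) (a : ℤ → ℤ) (ha : ∀ i, a i / 6 = c) :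
    ofRow i0 i1 a ∈ XX i0 i1 c := by
  intro v
  refine ⟨by rw [ofRow, FF_zpow_block, ha], ?_, ?_⟩
  · intro j h0 h1
    simp [ofRow, ee, h0.symm, h1.symm]
  · have e1 : (v + ee i1) i1 = 1 + v i1 := by simp [ee, add_comm]
    have e2 : (v + ee i1) i0 = v i0 := by simp [ee, h01]
    have e3 : (v + ee i0) i1 = v i1 := by simp [ee, h01.symm]
    have e4 : (v + ee i0) i0 = v i0 + 1 := by simp [ee]
    simp only [ofRow, e1, e2, e3, e4]
    rw [zpow_one_add, Equiv.Perm.mul_apply, FF_apply]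
    omega

lemma pt_i0 (h01 : i0 ≠ i1) (i j : ℤ) : pt i0 i1 i j i0 = i := by simp [pt, ee, h01]

lemma pt_i1 (h01 : i0 ≠ i1) (i j : ℤ) : pt i0 i1 i j i1 = j := by simp [pt, ee, h01.symm]

lemma XX_infinite (h01 : i0 ≠ i1) : (XX i0 i1 c).Infinite := by
  apply Set.infinite_of_injective_forall_mem
    (f := fun n : ℤ => ofRow i0 i1 (fun i => if i = n then 6 * c + 1 else 6 * c))
  · intro a b hab
    have := congrFun hab (pt i0 i1 a 0)
    simp only [ofRow, pt_i0 h01, pt_i1 h01, zpow_zero, Equiv.Perm.one_apply] at this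
    by_contra hne
    simp [hne] at this
  · intro n
    apply ofRow_mem h01
    intro i
    split_ifs <;> omega

lemma XX_bound {x : Config d} (hx : x ∈ XX i0 i1 c) (v : ZD d) :
    x v ∈ Finset.Icc (6 * c) (6 * c + 5) := by
  have := XX_block hx v
  rw [Finset.mem_Icc]; omega

/-- Horizontally periodic points. -/
def Per (i0 i1 : Fin d) (c : ℤ) (N : ℕ) : Set (Config d) :=
  {x | x ∈ XX i0 i1 c ∧ ∀ v, x (v + (N:ℤ) • ee i0) = x v}

lemma Per_finite (h01 : i0 ≠ i1) (N : ℕ) (hN : 0 < N) : (Per i0 i1 c N).Finite := by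
  let g : Config d → (Fin N → ℤ) := fun x k => x (pt i0 i1 (k:ℕ) 0)
  apply Set.Finite.of_finite_image (f := g)
  · apply (Set.Finite.pi' (t := fun _ : Fin N => ((Finset.Icc (6 * c) (6 * c + 5) : Finset ℤ) : Set ℤ))
      (fun _ => Finset.finite_toSet _)).subset
    rintro _ ⟨x, hx, rfl⟩ k
    exact XX_bound hx.1 _
  · intro x hx y hy hxy
    apply XX_row h01 hx.1 hy.1
    have hper : ∀ z ∈ Per i0 i1 c N, ∀ i k : ℤ, z (pt i0 i1 (i + N * k) 0) = z (pt i0 i1 i 0) := by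
      intro z hz i k
      have hp : Function.Periodic (fun i => z (pt i0 i1 i 0)) (N:ℤ) := by
        intro i
        have := hz.2 (pt i0 i1 i 0)
        have e : pt i0 i1 i 0 + (N:ℤ) • ee i0 = pt i0 i1 (i + N) 0 := by
          simp [pt, add_smul]
        rwa [e] at this
      have := hp.zsmul k i
      simp only [smul_eq_mul] at this
      rw [mul_comm]; exact this
    intro i
    have hN' : (0:ℤ) < N := by exact_mod_cast hN
    have e : i = i % N + N * (i / N) := (Int.emod_add_mul_ediv i N).symm
    have h0 := Int.emod_nonneg i hN'.ne'
    have h1 := Int.emod_lt_of_pos i hN'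
    rw [e, hper x hx, hper y hy]
    have := congrFun hxy ⟨(i % N).toNat, by omega⟩
    simp only [g] at this
    rwa [Int.toNat_of_nonneg h0] at this

lemma Per_shift (N : ℕ) (u : ZD d) {x : Config d} (hx : x ∈ Per i0 i1 c N) :
    shiftMap u x ∈ Per i0 i1 c N := by
  refine ⟨XX_shift u hx.1, fun v => ?_⟩
  have := hx.2 (u + v)
  simpa only [shiftMap, add_assoc] using this

lemma Per_closed (N : ℕ) : IsDeltaClosed (Per i0 i1 c N) := by
  rw [closed_iff]
  intro x hx
  refine ⟨closed_iff.1 XX_closed x fun m => ?_, fun v => ?_⟩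
  · obtain ⟨a, ha, h⟩ := hx m
    exact ⟨a, ha.1, h⟩
  · obtain ⟨a, ha, h⟩ := hx (max (normInf v) (normInf (v + (N:ℤ) • ee i0)))
    rw [h v (le_max_left _ _), h _ (le_max_right _ _), ha.2]

lemma Per_dense (h01 : i0 ≠ i1) {x : Config d} (hx : x ∈ XX i0 i1 c) (m : ℕ) :
    ∃ z ∈ Per i0 i1 c (4 * m + 1), Agree m x z := by
  set N := 4 * m + 1 with hN
  let a : ℤ → ℤ := fun i => x (pt i0 i1 (-m + (i + m) % (N:ℤ)) (-m))
  have ha : ∀ i, a i / 6 = c := fun i => XX_block hx _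
  have hper : ∀ i, a (i + N) = a i := by
    intro i
    simp only [a]
    rw [show i + (N:ℤ) + m = i + m + N by ring, Int.add_emod_right]
  let τ : Equiv.Perm (ℤ → ℤ) :=
    { toFun := fun b i => b (i + N)
      invFun := fun b i => b (i - N)
      left_inv := fun b => by ext i; simp
      right_inv := fun b => by ext i; simp }
  have hτ : ∀ b i, τ b i = b (i + N) := fun _ _ => rfl
  have hcomm : Commute FF τ := by
    apply Equiv.ext
    intro b
    ext i
    simp only [Equiv.Perm.mul_apply, FF_apply, hτ]
    rw [show i + 1 + (N:ℤ) = i + N + 1 by ring]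
  have hτa : τ a = a := by ext i; rw [hτ, hper]
  have hrow : ∀ j i : ℤ, (FF ^ j) a (i + N) = (FF ^ j) a i := by
    intro j i
    have := congrArg (fun f : Equiv.Perm (ℤ → ℤ) => f a i) (hcomm.zpow_left j).eq
    simp only [Equiv.Perm.mul_apply, hτa] at this
    rw [this, hτ]
  have hz0 : ofRow i0 i1 a ∈ Per i0 i1 c N := by
    refine ⟨ofRow_mem h01 a ha, fun v => ?_⟩
    have e1 : (v + (N:ℤ) • ee i0) i1 = v i1 := by simp [ee, h01.symm]
    have e2 : (v + (N:ℤ) • ee i0) i0 = v i0 + N := by simp [ee]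
    simp only [ofRow, e1, e2, hrow]
  have hz := Per_shift N (pt i0 i1 0 m) hz0
  refine ⟨_, hz, XX_agree h01 hx hz.1 m ?_⟩
  intro i hi
  simp only [shiftMap, pt_add, ofRow, pt_i0 h01, pt_i1 h01]
  simp only [add_neg_cancel, zpow_zero, Equiv.Perm.one_apply, zero_add, a]
  congr 2
  rw [Int.emod_eq_of_lt] <;> omega

end base

/-! ### Base-6 expansions -/

/-- The real number with the base-6 digits `a i % 6`. -/
noncomputable def SS (a : ℕ → ℤ) : ℝ := ∑' i, ((a i % 6 : ℤ) : ℝ) / 6 ^ (i + 1)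

lemma digit_bounds (n : ℤ) : (0:ℝ) ≤ ((n % 6 : ℤ) : ℝ) ∧ ((n % 6 : ℤ) : ℝ) ≤ 5 := by
  have h1 : 0 ≤ n % 6 := by omega
  have h2 : n % 6 ≤ 5 := by omega
  exact ⟨by exact_mod_cast h1, by exact_mod_cast h2⟩

lemma hasSum_five : HasSum (fun i : ℕ => (5:ℝ) / 6 ^ (i + 1)) 1 := by
  have := (hasSum_geometric_of_lt_one (r := (1/6:ℝ)) (by norm_num) (by norm_num)).mul_left (5/6)
  have e1 : (5/6:ℝ) * (1 - 1/6)⁻¹ = 1 := by norm_num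
  have e2 : (fun i : ℕ => (5/6:ℝ) * (1/6) ^ i) = fun i : ℕ => (5:ℝ) / 6 ^ (i + 1) := by
    ext i; rw [one_div_pow, pow_succ]; field_simp
  rw [e1, e2] at this
  exact this

lemma SS_term_le (a : ℕ → ℤ) (i : ℕ) :
    ((a i % 6 : ℤ) : ℝ) / 6 ^ (i + 1) ≤ 5 / 6 ^ (i + 1) := by
  have := (digit_bounds (a i)).2
  gcongr

lemma SS_term_nonneg (a : ℕ → ℤ) (i : ℕ) : 0 ≤ ((a i % 6 : ℤ) : ℝ) / 6 ^ (i + 1) := by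
  have := (digit_bounds (a i)).1
  positivity

lemma SS_summable (a : ℕ → ℤ) : Summable fun i => ((a i % 6 : ℤ) : ℝ) / 6 ^ (i + 1) :=
  Summable.of_nonneg_of_le (SS_term_nonneg a) (SS_term_le a) hasSum_five.summable

lemma SS_nonneg (a : ℕ → ℤ) : 0 ≤ SS a := tsum_nonneg (SS_term_nonneg a)

lemma SS_le_one (a : ℕ → ℤ) : SS a ≤ 1 := by
  rw [← hasSum_five.tsum_eq]
  exact (SS_summable a).tsum_le_tsum (SS_term_le a) hasSum_five.summable

lemma SS_succ (a : ℕ → ℤ) : 6 * SS a = ((a 0 % 6 : ℤ) : ℝ) + SS (fun i => a (i + 1)) := by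
  unfold SS
  rw [(SS_summable a).tsum_eq_zero_add, mul_add, ← tsum_mul_left]
  congr 1
  · simp; field_simp
  · congr 1; ext i; rw [pow_succ _ (i + 1)]; field_simp

lemma SS_two (a b : ℕ → ℤ) (h : ∀ i, b i % 6 = 2 * (a i % 3) + (a (i + 1) % 6) / 3) :
    SS b = 2 * SS a - ((a 0 % 6 / 3 : ℤ) : ℝ) := by
  have hH : Summable fun i => ((a i % 6 / 3 : ℤ) : ℝ) / 6 ^ i := by
    apply Summable.of_nonneg_of_le (g := fun i => ((a i % 6 / 3 : ℤ) : ℝ) / 6 ^ i) (f := fun i : ℕ => (6:ℝ) * (5 / 6 ^ (i + 1))) _ _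
      (hasSum_five.summable.mul_left 6)
    · intro i
      have h1 : (0:ℝ) ≤ ((a i % 6 / 3 : ℤ) : ℝ) := by
        have : 0 ≤ a i % 6 / 3 := by omega
        exact_mod_cast this
      positivity
    · intro i
      have h1 : ((a i % 6 / 3 : ℤ) : ℝ) ≤ 5 := by
        have : a i % 6 / 3 ≤ 5 := by omega
        exact_mod_cast this
      rw [pow_succ, show (6:ℝ) * (5 / (6 ^ i * 6)) = 5 / 6 ^ i by field_simp]
      gcongr
  have hH1 := (summable_nat_add_iff 1).2 hH
  have e0 := hH.tsum_eq_zero_add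
  have key : ∀ i, ((b i % 6 : ℤ) : ℝ) / 6 ^ (i + 1) = 2 * (((a i % 6 : ℤ) : ℝ) / 6 ^ (i + 1))
      - ((a i % 6 / 3 : ℤ) : ℝ) / 6 ^ i + ((a (i + 1) % 6 / 3 : ℤ) : ℝ) / 6 ^ (i + 1) := by
    intro i
    have : b i % 6 = 2 * (a i % 6) - 6 * (a i % 6 / 3) + a (i + 1) % 6 / 3 := by
      rw [h i]; omega
    rw [this]
    push_cast
    rw [pow_succ]
    field_simp
  unfold SS
  rw [tsum_congr key, (((SS_summable a).mul_left 2).sub hH).tsum_add hH1,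
    ((SS_summable a).mul_left 2).tsum_sub hH, tsum_mul_left, e0, pow_zero, div_one]
  ring

lemma SS_tail (b : ℕ → ℤ) (N : ℕ) (h0 : 0 < SS (fun i => b (i + N)))
    (h1 : SS (fun i => b (i + N)) < 1) : 0 < SS b ∧ SS b < 1 := by
  induction N with
  | zero => exact ⟨h0, h1⟩
  | succ N ih =>
    have e := SS_succ (fun i => b (i + N))
    have e2 : (fun i => b (i + 1 + N)) = fun i => b (i + (N + 1)) := by
      ext i; congr 1; omega
    simp only [e2] at e
    have := digit_bounds (b (0 + N))
    apply ih <;> linarith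

lemma SS_unique (N : ℕ) : ∀ (a b : ℕ → ℤ), SS a = SS b → 0 < SS (fun i => b (i + N)) →
    SS (fun i => b (i + N)) < 1 → ∀ i < N, a i % 6 = b i % 6 := by
  induction N with
  | zero => intro a b _ _ _ i hi; omega
  | succ N ih =>
    intro a b hab h0 h1
    have e2 : (fun i => b (i + (N + 1))) = fun i => (fun k => b (k + 1)) (i + N) := by
      ext i; simp only []; congr 1
    rw [e2] at h0 h1
    obtain ⟨p0, p1⟩ := SS_tail (fun k => b (k + 1)) N h0 h1
    have ea := SS_succ a
    have eb := SS_succ b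
    have q0 := SS_nonneg (fun k => a (k + 1))
    have q1 := SS_le_one (fun k => a (k + 1))
    have hd : a 0 % 6 = b 0 % 6 := by
      have l1 : ((a 0 % 6 : ℤ) : ℝ) < ((b 0 % 6 + 1 : ℤ) : ℝ) := by push_cast; push_cast at *; linarith
      have l2 : ((b 0 % 6 : ℤ) : ℝ) < ((a 0 % 6 + 1 : ℤ) : ℝ) := by push_cast; push_cast at *; linarith
      have l1' := Int.cast_lt.1 l1
      have l2' := Int.cast_lt.1 l2
      omega
    have ht : SS (fun k => a (k + 1)) = SS (fun k => b (k + 1)) := by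
      rw [hd] at ea; linarith
    intro i hi
    cases i with
    | zero => exact hd
    | succ i => exact ih _ _ ht h0 h1 i (by omega)

lemma SS_const_two : 0 < SS (fun _ => 2) ∧ SS (fun _ => 2) < 1 := by
  have := SS_succ (fun _ => 2)
  norm_num at this
  constructor <;> linarith

section TTsec
variable {d : ℕ} {i0 i1 : Fin d} {c : ℤ}

/-- The real number coded by the right half of row `0`. -/
noncomputable def TT (i0 i1 : Fin d) (x : Config d) : ℝ := SS (fun i : ℕ => x (pt i0 i1 i 0))

lemma TT_nonneg (x : Config d) : 0 ≤ TT i0 i1 x := SS_nonneg _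

lemma TT_le_one (x : Config d) : TT i0 i1 x ≤ 1 := SS_le_one _

lemma TT_e0 (x : Config d) :
    6 * TT i0 i1 x = ((x 0 % 6 : ℤ) : ℝ) + TT i0 i1 (shiftMap (ee i0) x) := by
  unfold TT
  rw [SS_succ]
  congr 2
  · simp [pt_zero]
  · ext i
    simp only [shiftMap]
    rw [add_comm (ee i0), pt_add_e0]; simp

lemma TT_e1 {x : Config d} (hx : x ∈ XX i0 i1 c) :
    TT i0 i1 (shiftMap (ee i1) x) = 2 * TT i0 i1 x - ((x 0 % 6 / 3 : ℤ) : ℝ) := by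
  unfold TT
  rw [SS_two (fun i : ℕ => x (pt i0 i1 i 0))]
  · simp [pt_zero]
  · intro i
    have := XX_rule hx i 0
    simp only [shiftMap]
    rw [add_comm (ee i1), pt_add_e1, this]; simp

lemma TT_continuous : Continuous (TT i0 i1 : Config d → ℝ) := by
  unfold TT SS
  apply continuous_tsum (u := fun i : ℕ => (5:ℝ) / 6 ^ (i + 1))
  · intro i
    have h1 : Continuous fun x : Config d => x (pt i0 i1 i 0) := continuous_apply _
    have h2 : Continuous fun n : ℤ => ((n % 6 : ℤ) : ℝ) / 6 ^ (i + 1) := continuous_of_discreteTopology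
    exact h2.comp h1
  · exact hasSum_five.summable
  · intro i x
    rw [Real.norm_of_nonneg (SS_term_nonneg (fun i : ℕ => x (pt i0 i1 i 0)) i)]
    exact SS_term_le (fun i : ℕ => x (pt i0 i1 i 0)) i

/-- The point of the circle. -/
noncomputable def TC (i0 i1 : Fin d) (x : Config d) : UnitAddCircle := ((TT i0 i1 x : ℝ) : UnitAddCircle)

lemma circ_int (n : ℤ) : (((n : ℝ)) : UnitAddCircle) = 0 := by
  rw [AddCircle.coe_eq_zero_iff]
  exact ⟨n, by simp⟩

lemma circ_eq {s t : ℝ} (hs0 : 0 ≤ s) (hs1 : s ≤ 1) (ht0 : 0 ≤ t) (ht1 : t ≤ 1)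
    (h : (s : UnitAddCircle) = t) : s = t ∨ (s = 0 ∧ t = 1) ∨ (s = 1 ∧ t = 0) := by
  have : ((s - t : ℝ) : UnitAddCircle) = 0 := by rw [AddCircle.coe_sub, h, sub_self]
  rw [AddCircle.coe_eq_zero_iff] at this
  obtain ⟨n, hn⟩ := this
  simp only [zsmul_eq_mul, mul_one] at hn
  have l1 : (n:ℝ) ≤ ((1:ℤ):ℝ) := by push_cast; linarith
  have l2 : ((-1:ℤ):ℝ) ≤ (n:ℝ) := by push_cast; linarith
  have l1' := Int.cast_le.1 l1
  have l2' := Int.cast_le.1 l2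
  have : n = -1 ∨ n = 0 ∨ n = 1 := by omega
  rcases this with rfl | rfl | rfl
  · push_cast at hn
    right; left; constructor <;> linarith
  · push_cast at hn
    left; linarith
  · push_cast at hn
    right; right; constructor <;> linarith

lemma TC_e0 (x : Config d) : TC i0 i1 (shiftMap (ee i0) x) = 6 • TC i0 i1 x := by
  unfold TC
  have : TT i0 i1 (shiftMap (ee i0) x) = 6 • TT i0 i1 x - ((x 0 % 6 : ℤ) : ℝ) := by
    have := TT_e0 (i0 := i0) (i1 := i1) x
    simp only [nsmul_eq_mul]; push_cast at *; linarith
  rw [this, AddCircle.coe_sub, circ_int, sub_zero, AddCircle.coe_nsmul]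

lemma TC_e1 {x : Config d} (hx : x ∈ XX i0 i1 c) :
    TC i0 i1 (shiftMap (ee i1) x) = 2 • TC i0 i1 x := by
  unfold TC
  have : TT i0 i1 (shiftMap (ee i1) x) = 2 • TT i0 i1 x - ((x 0 % 6 / 3 : ℤ) : ℝ) := by
    rw [TT_e1 hx]; simp
  rw [this, AddCircle.coe_sub, circ_int, sub_zero, AddCircle.coe_nsmul]

lemma TC_continuous : Continuous (TC i0 i1 : Config d → UnitAddCircle) :=
  (AddCircle.continuous_mk' 1).comp TT_continuous

lemma TT_zero {x : Config d} (h : TT i0 i1 x = 0) : TT i0 i1 (shiftMap (ee i0) x) = 0 := by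
  have e := TT_e0 (i0 := i0) (i1 := i1) x
  have := digit_bounds (x 0)
  have := TT_nonneg (i0 := i0) (i1 := i1) (shiftMap (ee i0) x)
  rw [h] at e; linarith

lemma TT_one {x : Config d} (h : TT i0 i1 x = 1) : TT i0 i1 (shiftMap (ee i0) x) = 1 := by
  have e := TT_e0 (i0 := i0) (i1 := i1) x
  have := digit_bounds (x 0)
  have := TT_le_one (i0 := i0) (i1 := i1) (shiftMap (ee i0) x)
  rw [h] at e; linarith

lemma shift_neg (u : ZD d) (x : Config d) : shiftMap u (shiftMap (-u) x) = x := by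
  rw [shiftMap_add, neg_add_cancel, shiftMap_zero]

lemma finite_case (h01 : i0 ≠ i1) {Z : Set (Config d)} (hZX : Z ⊆ XX i0 i1 c)
    (hs : ∀ u : ZD d, ∀ z ∈ Z, shiftMap u z ∈ Z) (hA : (TC i0 i1 '' Z).Finite) : Z.Finite := by
  have hinj : Set.InjOn (fun t : UnitAddCircle => 6 • t) (TC i0 i1 '' Z) := by
    have hmaps : Set.MapsTo (fun t : UnitAddCircle => 6 • t) (TC i0 i1 '' Z) (TC i0 i1 '' Z) := by
      rintro _ ⟨x, hx, rfl⟩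
      exact ⟨_, hs (ee i0) x hx, TC_e0 x⟩
    have hsurj : Set.SurjOn (fun t : UnitAddCircle => 6 • t) (TC i0 i1 '' Z) (TC i0 i1 '' Z) := by
      rintro _ ⟨x, hx, rfl⟩
      refine ⟨_, ⟨_, hs (-ee i0) x hx, rfl⟩, ?_⟩
      simp only []
      rw [← TC_e0, shift_neg]
    have : Finite (TC i0 i1 '' Z) := hA
    rw [← hmaps.restrict_inj, Finite.injective_iff_surjective, hmaps.restrict_surjective_iff]
    exact hsurj
  have fwd : ∀ x ∈ Z, ∀ y ∈ Z, TT i0 i1 x = TT i0 i1 y →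
      TT i0 i1 (shiftMap (ee i0) x) = TT i0 i1 (shiftMap (ee i0) y) := by
    have aux : ∀ x ∈ Z, ∀ y ∈ Z, TT i0 i1 x = TT i0 i1 y →
      TT i0 i1 (shiftMap (ee i0) x) = 0 → TT i0 i1 (shiftMap (ee i0) y) = 1 → False := by
      intro x hx y hy hxy h0 h1
      have hc0 : TC i0 i1 (shiftMap (ee i0) x) = 0 := by unfold TC; rw [h0]; rfl
      have : TC i0 i1 x = TC i0 i1 (shiftMap (ee i0) x) := by
        apply hinj ⟨x, hx, rfl⟩ ⟨_, hs _ x hx, rfl⟩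
        simp only []
        rw [← TC_e0, hc0, smul_zero]
      rcases circ_eq (TT_nonneg _) (TT_le_one _) (TT_nonneg _) (TT_le_one _) this with h | h | h
      · rw [h0] at h
        have := TT_zero (hxy.symm.trans h); linarith
      · linarith
      · have := TT_one h.1
        linarith
    intro x hx y hy hxy
    have : TC i0 i1 (shiftMap (ee i0) x) = TC i0 i1 (shiftMap (ee i0) y) := by
      rw [TC_e0, TC_e0]; unfold TC; rw [hxy]
    rcases circ_eq (TT_nonneg _) (TT_le_one _) (TT_nonneg _) (TT_le_one _) this with h | h | h
    · exact h
    · exact (aux x hx y hy hxy h.1 h.2).elim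
    · exact (aux y hy x hx hxy.symm h.2 h.1).elim
  have bwd : ∀ x ∈ Z, ∀ y ∈ Z, TT i0 i1 (shiftMap (ee i0) x) = TT i0 i1 (shiftMap (ee i0) y) →
      TT i0 i1 x = TT i0 i1 y := by
    intro x hx y hy hxy
    have : TC i0 i1 x = TC i0 i1 y := by
      apply hinj ⟨x, hx, rfl⟩ ⟨y, hy, rfl⟩
      simp only []
      rw [← TC_e0, ← TC_e0]; unfold TC; rw [hxy]
    rcases circ_eq (TT_nonneg _) (TT_le_one _) (TT_nonneg _) (TT_le_one _) this with h | h | h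
    · exact h
    · have a1 := TT_zero h.1
      have a2 := TT_one h.2
      linarith
    · have a1 := TT_one h.1
      have a2 := TT_zero h.2
      linarith
  have hTinj : Set.InjOn (TT i0 i1) Z := by
    intro x hx y hy hxy
    have all : ∀ k : ℤ, TT i0 i1 (shiftMap (pt i0 i1 k 0) x) = TT i0 i1 (shiftMap (pt i0 i1 k 0) y) := by
      intro k
      induction k using Int.induction_on with
      | zero => rwa [pt_zero, shiftMap_zero, shiftMap_zero]
      | succ k ih =>
        have := fwd _ (hs _ x hx) _ (hs _ y hy) ih
        rwa [shiftMap_add, shiftMap_add, pt_add_e0] at this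
      | pred k ih =>
        apply bwd _ (hs _ x hx) _ (hs _ y hy)
        rwa [shiftMap_add, shiftMap_add, pt_add_e0, sub_add_cancel]
    apply XX_row h01 (hZX hx) (hZX hy)
    intro k
    have e1 := TT_e0 (i0 := i0) (i1 := i1) (shiftMap (pt i0 i1 k 0) x)
    have e2 := TT_e0 (i0 := i0) (i1 := i1) (shiftMap (pt i0 i1 k 0) y)
    rw [shiftMap_add, pt_add_e0] at e1 e2
    rw [all k, all (k + 1)] at e1
    simp only [shiftMap, add_zero] at e1 e2
    have : ((x (pt i0 i1 k 0) % 6 : ℤ) : ℝ) = ((y (pt i0 i1 k 0) % 6 : ℤ) : ℝ) := by linarith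
    have := Int.cast_injective this
    have b1 := XX_block (hZX hx) (pt i0 i1 k 0)
    have b2 := XX_block (hZX hy) (pt i0 i1 k 0)
    omega
  have hT : (TT i0 i1 '' Z).Finite := by
    -- each circle point has finitely many representatives
    have : ∀ s : UnitAddCircle, {t : ℝ | 0 ≤ t ∧ t ≤ 1 ∧ (t : UnitAddCircle) = s}.Finite := by
      intro s
      by_cases hne : {t : ℝ | 0 ≤ t ∧ t ≤ 1 ∧ (t : UnitAddCircle) = s}.Nonempty
      · obtain ⟨t0, h0, h1, hs⟩ := hne
        apply (Set.toFinite {t0, 0, 1}).subset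
        rintro t ⟨ht0, ht1, hts⟩
        rcases circ_eq ht0 ht1 h0 h1 (hts.trans hs.symm) with h | h | h
        · simp [h]
        · simp [h.1]
        · simp [h.1]
      · rw [Set.not_nonempty_iff_eq_empty] at hne
        rw [hne]; exact Set.finite_empty
    apply (hA.biUnion (fun s _ => this s)).subset
    rintro _ ⟨x, hx, rfl⟩
    simp only [Set.mem_iUnion]
    exact ⟨TC i0 i1 x, ⟨x, hx, rfl⟩, TT_nonneg _, TT_le_one _, rfl⟩
  exact Set.Finite.of_finite_image hT hTinj

lemma full_case (h01 : i0 ≠ i1) {Z : Set (Config d)} (hZX : Z ⊆ XX i0 i1 c)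
    (hcl : IsDeltaClosed Z)
    (hs : ∀ u : ZD d, ∀ z ∈ Z, shiftMap u z ∈ Z) (hA : TC i0 i1 '' Z = Set.univ) :
    Z = XX i0 i1 c := by
  apply Set.Subset.antisymm hZX
  intro x hx
  apply closed_iff.1 hcl
  intro m
  set y := shiftMap (pt i0 i1 (-m) (-m)) x with hy
  have hyX : y ∈ XX i0 i1 c := XX_shift _ hx
  let b : ℕ → ℤ := fun i => if i < 4 * m + 1 then y (pt i0 i1 i 0) else 2
  have htail : (fun i => b (i + (4 * m + 1))) = fun _ => 2 := by
    ext i; simp only [b]; rw [if_neg (by omega)]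
  have h0 : 0 < SS (fun i => b (i + (4 * m + 1))) := by rw [htail]; exact SS_const_two.1
  have h1 : SS (fun i => b (i + (4 * m + 1))) < 1 := by rw [htail]; exact SS_const_two.2
  obtain ⟨b0, b1⟩ := SS_tail b _ h0 h1
  have : ((SS b : ℝ) : UnitAddCircle) ∈ TC i0 i1 '' Z := by rw [hA]; trivial
  obtain ⟨z, hz, hzb⟩ := this
  have hTz : TT i0 i1 z = SS b := by
    rcases circ_eq (TT_nonneg _) (TT_le_one _) b0.le b1.le hzb with h | h | h
    · exact h
    · linarith
    · linarith
  have hdig := SS_unique (4 * m + 1) _ b hTz h0 h1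
  refine ⟨_, hs (pt i0 i1 m m) z hz, XX_agree h01 hx (XX_shift _ (hZX hz)) m ?_⟩
  intro i hi
  have h2 := hdig i (by omega)
  simp only [b] at h2
  rw [if_pos (by omega)] at h2
  simp only [hy, shiftMap, pt_add] at h2 ⊢
  have k1 := XX_block (hZX hz) (pt i0 i1 i 0)
  have k2 := XX_block hx (pt i0 i1 (-m + i) (-m + 0))
  rw [add_zero] at k2 h2
  rw [show (m:ℤ) + (-m + i) = i by ring, add_neg_cancel]
  omega

/-- Every subsystem of the base shift is finite or everything. -/
lemma dichotomy (h01 : i0 ≠ i1) {Z : Set (Config d)} (hZX : Z ⊆ XX i0 i1 c)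
    (hcl : IsDeltaClosed Z) (hs : ∀ u : ZD d, ∀ z ∈ Z, shiftMap u z ∈ Z) :
    Z.Finite ∨ Z = XX i0 i1 c := by
  have hcomp : IsCompact Z := by
    apply IsCompact.of_isClosed_subset (isCompact_univ_pi
      (s := fun _ : ZD d => ((Finset.Icc (6 * c) (6 * c + 5) : Finset ℤ) : Set ℤ))
      (fun _ => (Finset.finite_toSet _).isCompact)) (isClosed_of_deltaClosed hcl)
    intro x hx v _
    exact XX_bound (hZX hx) v
  have hAc : IsClosed (TC i0 i1 '' Z) := (hcomp.image TC_continuous).isClosed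
  have k2 : ∀ t ∈ TC i0 i1 '' Z, 2 • t ∈ TC i0 i1 '' Z := by
    rintro _ ⟨x, hx, rfl⟩
    exact ⟨_, hs (ee i1) x hx, TC_e1 (hZX hx)⟩
  have k3 : ∀ t ∈ TC i0 i1 '' Z, 3 • t ∈ TC i0 i1 '' Z := by
    rintro _ ⟨x, hx, rfl⟩
    refine ⟨_, hs (ee i0) _ (hs (-ee i1) x hx), ?_⟩
    have e := TC_e1 (hZX (hs (-ee i1) x hx))
    rw [shift_neg] at e
    rw [TC_e0, e, smul_smul]
    norm_num
  rcases furstenberg hAc k2 k3 with h | h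
  · exact Or.inl (finite_case h01 hZX hs h)
  · exact Or.inr (full_case h01 hZX hcl hs h)

end TTsec

/-! ### Cantor–Bendixson derivatives -/

lemma CBderiv_anti (d n k : ℕ) : CBderiv d (n + k) ⊆ CBderiv d n := by
  induction k with
  | zero => exact subset_rfl
  | succ k ih => exact fun X hX => ih hX.1

lemma CB_abstract {d : ℕ} (P : ℕ → Set (Config d) → Prop)
    (hs : ∀ r Z, P r Z → IsShift Z)
    (ha : ∀ r Z, P r Z → ∃ ε : ℝ, 0 < ε ∧ ∀ W, IsShift W → deltaH Z W < ε →
      W = Z ∨ ∃ r' < r, P r' W)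
    (hb : ∀ r Z, P (r + 1) Z → ∀ ε : ℝ, 0 < ε → ∃ W, P r W ∧ deltaH Z W < ε ∧ W ≠ Z) :
    ∀ r Z, P r Z → Z ∈ CBderiv d r ∧ IsolatedIn (CBderiv d r) Z := by
  intro r
  induction r using Nat.strong_induction_on with
  | _ r ih =>
    intro Z hZ
    have hmem : Z ∈ CBderiv d r := by
      cases r with
      | zero => exact hs 0 Z hZ
      | succ r =>
        have key : ∀ k, k ≤ r + 1 → Z ∈ CBderiv d k := by
          intro k
          induction k with
          | zero => intro _; exact hs _ Z hZ
          | succ k ihk =>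
            intro hk
            refine ⟨ihk (by omega), ?_⟩
            rintro ⟨_, ε, hε, h⟩
            obtain ⟨W, hW, hd, hne⟩ := hb r Z hZ ε hε
            apply hne
            apply h W _ hd
            have := (ih r (by omega) W hW).1
            obtain ⟨j, rfl⟩ := Nat.exists_eq_add_of_le (show k ≤ r by omega)
            exact CBderiv_anti d k j this
        exact key _ le_rfl
    refine ⟨hmem, hmem, ?_⟩
    obtain ⟨ε, hε, h⟩ := ha r Z hZ
    refine ⟨ε, hε, fun W hW hd => ?_⟩
    have hW0 : IsShift W := by
      have := CBderiv_anti d 0 r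
      rw [zero_add] at this
      exact this hW
    rcases h W hW0 hd with h | ⟨r', hr', hP⟩
    · exact h
    · exfalso
      have h1 := (ih r' hr' W hP).2
      obtain ⟨j, rfl⟩ := Nat.exists_eq_add_of_le (show r' + 1 ≤ r by omega)
      exact (CBderiv_anti d (r' + 1) j hW).2 h1

section family
variable {d : ℕ} {i0 i1 : Fin d} {n : ℕ}

/-- Unions of subsystems of the base shifts, with exactly `r` of them full. -/
def PP (i0 i1 : Fin d) (n r : ℕ) (Z : Set (Config d)) : Prop :=
  ∃ Zs : Fin (n + 1) → Set (Config d),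
    (∀ i, IsSubsystem (Zs i) (XX i0 i1 ((i : ℕ) : ℤ))) ∧ Z = ⋃ i, Zs i ∧
      {i | Zs i = XX i0 i1 ((i : ℕ) : ℤ)}.ncard = r

lemma same_index {m : ℕ} {i k : Fin (n + 1)} {x y : Config d} (hx : x ∈ XX i0 i1 ((i : ℕ) : ℤ))
    (hy : y ∈ XX i0 i1 ((k : ℕ) : ℤ)) (h : Agree m x y) : k = i := by
  have b1 := XX_block hx 0
  have b2 := XX_block hy 0
  rw [h 0 normInf_zero'] at b1
  apply Fin.ext
  omega

lemma PP_shift (r : ℕ) (Z : Set (Config d)) (h : PP i0 i1 n r Z) : IsShift Z := by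
  obtain ⟨Zs, hZs, rfl, -⟩ := h
  refine ⟨?_, ⟨Finset.Icc 0 (6 * (n + 1)), ?_⟩, ?_, ?_⟩
  · obtain ⟨z, hz⟩ := (hZs 0).1
    exact ⟨z, Set.mem_iUnion.2 ⟨0, hz⟩⟩
  · intro x hx v
    obtain ⟨i, hi⟩ := Set.mem_iUnion.1 hx
    have := XX_block ((hZs i).2.1 hi) v
    have := i.2
    rw [Finset.mem_Icc]; omega
  · rw [closed_iff]
    intro x hx
    obtain ⟨a, ha, hxa⟩ := hx 0
    obtain ⟨i, hi⟩ := Set.mem_iUnion.1 ha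
    refine Set.mem_iUnion.2 ⟨i, closed_iff.1 (hZs i).2.2.1 x fun m => ?_⟩
    obtain ⟨b, hb, hxb⟩ := hx m
    obtain ⟨k, hk⟩ := Set.mem_iUnion.1 hb
    have : k = i := same_index ((hZs i).2.1 hi) ((hZs k).2.1 hk)
      (hxa.symm.trans (hxb.mono (Nat.zero_le m)))
    subst this
    exact ⟨b, hk, hxb⟩
  · intro u x hx
    obtain ⟨i, hi⟩ := Set.mem_iUnion.1 hx
    exact Set.mem_iUnion.2 ⟨i, (hZs i).2.2.2 u x hi⟩

lemma PP_a (h01 : i0 ≠ i1) (r : ℕ) (Z : Set (Config d)) (h : PP i0 i1 n r Z) :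
    ∃ ε : ℝ, 0 < ε ∧ ∀ W, IsShift W → deltaH Z W < ε →
      W = Z ∨ ∃ r' < r, PP i0 i1 n r' W := by
  have hZsh := PP_shift r Z h
  obtain ⟨Zs, hZs, hZ, hr⟩ := h
  have hiso : ∀ i, ∃ m : ℕ, (Zs i).Finite → ∀ W : Set (Config d),
      (∀ u : ZD d, ∀ x ∈ W, shiftMap u x ∈ W) →
      (∀ w ∈ W, ∃ z ∈ Zs i, Agree m w z) → (∀ z ∈ Zs i, ∃ w ∈ W, Agree m w z) → W = Zs i := by
    intro i
    by_cases hf : (Zs i).Finite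
    · obtain ⟨m, hm⟩ := finite_isolated (Zs i) hf (hZs i).2.2.2
      exact ⟨m, fun _ => hm⟩
    · exact ⟨0, fun h => absurd h hf⟩
  choose ms hms using hiso
  let M := 1 + Finset.univ.sup ms
  have hM : ∀ i, ms i ≤ M := fun i =>
    (Finset.le_sup (f := ms) (Finset.mem_univ i)).trans (Nat.le_add_left _ _)
  have hM1 : 1 ≤ M := Nat.le_add_right _ _
  refine ⟨(2:ℝ) ^ (-(M:ℤ)), by positivity, fun W hW hd => ?_⟩
  obtain ⟨n1, n2⟩ := deltaH_lt hZsh.1 hW.1 hd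
  obtain ⟨-, -, hWc, hWs⟩ := hW
  have hcover : ∀ w ∈ W, ∃ i : Fin (n + 1), w ∈ XX i0 i1 ((i : ℕ) : ℤ) := by
    intro w hw
    have hloc : ∀ u : ZD d, ∃ i : Fin (n + 1), ∃ z ∈ XX i0 i1 ((i : ℕ) : ℤ),
        Agree 1 (shiftMap u w) z := by
      intro u
      obtain ⟨z, hz, hzw⟩ := n2 _ (hWs u w hw)
      rw [hZ] at hz
      obtain ⟨i, hi⟩ := Set.mem_iUnion.1 hz
      exact ⟨i, z, (hZs i).2.1 hi, (hzw.mono hM1).symm⟩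
    have hconst : ∀ u, w u / 6 = w 0 / 6 := by
      apply const_of_steps (fun u => w u / 6)
      intro j u
      obtain ⟨i, z, hz, hag⟩ := hloc u
      have e1 := hag (ee j) (ee_norm j)
      have e2 := hag 0 normInf_zero'
      simp only [shiftMap, add_zero] at e1 e2
      rw [e1, e2, XX_block hz, XX_block hz]
    obtain ⟨i, z, hz, hag⟩ := hloc 0
    refine ⟨i, fun u => ?_⟩
    have l0 := Loc_of_agree hz hag
    obtain ⟨k, z', hz', hag'⟩ := hloc u
    have l1 := Loc_of_agree hz' hag'
    have : ((k : ℕ) : ℤ) = ((i : ℕ) : ℤ) := by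
      rw [← l0.1, ← l1.1, hconst u]
    rw [← this]; exact l1
  set Ws : Fin (n + 1) → Set (Config d) := fun i => W ∩ XX i0 i1 ((i : ℕ) : ℤ) with hWsdef
  have hWU : W = ⋃ i, Ws i := by
    ext w
    simp only [hWsdef, Set.mem_iUnion, Set.mem_inter_iff]
    exact ⟨fun hw => (hcover w hw).imp fun i hi => ⟨hw, hi⟩, fun ⟨i, hi⟩ => hi.1⟩
  have near1 : ∀ i, ∀ z ∈ Zs i, ∃ w ∈ Ws i, Agree M w z := by
    intro i z hz
    obtain ⟨w, hw, hzw⟩ := n1 z (by rw [hZ]; exact Set.mem_iUnion.2 ⟨i, hz⟩)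
    obtain ⟨k, hk⟩ := hcover w hw
    have := same_index ((hZs i).2.1 hz) hk hzw
    subst this
    exact ⟨w, ⟨hw, hk⟩, hzw.symm⟩
  have near2 : ∀ i, ∀ w ∈ Ws i, ∃ z ∈ Zs i, Agree M w z := by
    intro i w hw
    obtain ⟨z, hz, hzw⟩ := n2 w hw.1
    rw [hZ] at hz
    obtain ⟨k, hk⟩ := Set.mem_iUnion.1 hz
    have := same_index hw.2 ((hZs k).2.1 hk) hzw.symm
    subst this
    exact ⟨z, hk, hzw.symm⟩
  have hsub : ∀ i, IsSubsystem (Ws i) (XX i0 i1 ((i : ℕ) : ℤ)) := by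
    intro i
    refine ⟨?_, Set.inter_subset_right, ?_, ?_⟩
    · obtain ⟨z, hz⟩ := (hZs i).1
      obtain ⟨w, hw, -⟩ := near1 i z hz
      exact ⟨w, hw⟩
    · rw [closed_iff]
      intro x hx
      refine ⟨closed_iff.1 hWc x fun m => ?_, closed_iff.1 XX_closed x fun m => ?_⟩
      · obtain ⟨a, ha, h⟩ := hx m
        exact ⟨a, ha.1, h⟩
      · obtain ⟨a, ha, h⟩ := hx m
        exact ⟨a, ha.2, h⟩
    · intro u x hx
      exact ⟨hWs u x hx.1, XX_shift u hx.2⟩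
  have hfin : ∀ i, Zs i ≠ XX i0 i1 ((i : ℕ) : ℤ) → Ws i = Zs i := by
    intro i hne
    have hf : (Zs i).Finite :=
      (dichotomy h01 (hZs i).2.1 (hZs i).2.2.1 (hZs i).2.2.2).resolve_right hne
    apply hms i hf (Ws i) (hsub i).2.2.2
    · intro w hw
      obtain ⟨z, hz, h⟩ := near2 i w hw
      exact ⟨z, hz, h.mono (hM i)⟩
    · intro z hz
      obtain ⟨w, hw, h⟩ := near1 i z hz
      exact ⟨w, hw, h.mono (hM i)⟩
  have hsubset : {i | Ws i = XX i0 i1 ((i : ℕ) : ℤ)} ⊆ {i | Zs i = XX i0 i1 ((i : ℕ) : ℤ)} := by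
    intro i hi
    by_contra hne
    have := hfin i hne
    exact hne (this.symm.trans hi)
  have hle := Set.ncard_le_ncard hsubset (Set.toFinite _)
  rcases hle.lt_or_eq with hlt | heq
  · right
    exact ⟨_, hr ▸ hlt, Ws, hsub, hWU, rfl⟩
  · left
    have hseteq := Set.eq_of_subset_of_ncard_le hsubset heq.ge (Set.toFinite _)
    rw [hWU, hZ]
    congr 1
    ext1 i
    by_cases hi : Zs i = XX i0 i1 ((i : ℕ) : ℤ)
    · have : i ∈ {i | Ws i = XX i0 i1 ((i : ℕ) : ℤ)} := by rw [hseteq]; exact hi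
      rw [hi]; exact this
    · exact hfin i hi

lemma PP_b (h01 : i0 ≠ i1) (r : ℕ) (Z : Set (Config d)) (h : PP i0 i1 n (r + 1) Z) (ε : ℝ)
    (hε : 0 < ε) : ∃ W, PP i0 i1 n r W ∧ deltaH Z W < ε ∧ W ≠ Z := by
  classical
  have hZsh := PP_shift _ Z h
  obtain ⟨Zs, hZs, hZ, hr⟩ := h
  obtain ⟨m, hm⟩ := exists_two_pow_lt hε
  have hne : {i | Zs i = XX i0 i1 ((i : ℕ) : ℤ)}.Nonempty := by
    rw [← Set.ncard_pos (Set.toFinite _)]; omega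
  obtain ⟨i, hi⟩ := hne
  have hfull : Zs i = XX i0 i1 ((i : ℕ) : ℤ) := hi
  have hPfin : (Per i0 i1 ((i : ℕ) : ℤ) (4 * m + 1)).Finite := Per_finite h01 _ (by omega)
  let Vs : Fin (n + 1) → Set (Config d) :=
    fun k => if k = i then Per i0 i1 ((i : ℕ) : ℤ) (4 * m + 1) else Zs k
  have hVi : Vs i = Per i0 i1 ((i : ℕ) : ℤ) (4 * m + 1) := if_pos rfl
  have hVk : ∀ k, k ≠ i → Vs k = Zs k := fun k hk => if_neg hk
  have hVs : ∀ k, IsSubsystem (Vs k) (XX i0 i1 ((k : ℕ) : ℤ)) := by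
    intro k
    by_cases hk : k = i
    · subst hk
      rw [hVi]
      refine ⟨?_, fun x hx => hx.1, Per_closed _, fun u x hx => Per_shift _ u hx⟩
      obtain ⟨x, hx⟩ := (XX_infinite (c := ((k : ℕ) : ℤ)) h01).nonempty
      obtain ⟨z, hz, -⟩ := Per_dense h01 hx m
      exact ⟨z, hz⟩
    · rw [hVk k hk]; exact hZs k
  have hPP : PP i0 i1 n r (⋃ k, Vs k) := by
    refine ⟨Vs, hVs, rfl, ?_⟩
    have : {k | Vs k = XX i0 i1 ((k : ℕ) : ℤ)} = {k | Zs k = XX i0 i1 ((k : ℕ) : ℤ)} \ {i} := by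
      ext k
      simp only [Set.mem_setOf_eq, Set.mem_diff, Set.mem_singleton_iff]
      by_cases hk : k = i
      · subst hk
        simp only [not_true, and_false, iff_false, hVi]
        intro h
        rw [h] at hPfin
        exact XX_infinite h01 hPfin
      · simp [hVk k hk, hk]
    rw [this, Set.ncard_diff_singleton_of_mem hi, hr]; rfl
  refine ⟨_, hPP, ?_, ?_⟩
  · apply lt_of_le_of_lt _ hm
    apply deltaH_le hZsh.1 (PP_shift _ _ hPP).1
    · intro x hx
      rw [hZ] at hx
      obtain ⟨k, hk⟩ := Set.mem_iUnion.1 hx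
      by_cases hki : k = i
      · subst hki
        rw [hfull] at hk
        obtain ⟨z, hz, hxz⟩ := Per_dense h01 hk m
        exact ⟨z, Set.mem_iUnion.2 ⟨k, by rw [hVi]; exact hz⟩, hxz⟩
      · exact ⟨x, Set.mem_iUnion.2 ⟨k, by rw [hVk k hki]; exact hk⟩, fun _ _ => rfl⟩
    · intro z hz
      obtain ⟨k, hk⟩ := Set.mem_iUnion.1 hz
      refine ⟨z, ?_, fun _ _ => rfl⟩
      rw [hZ]
      refine Set.mem_iUnion.2 ⟨k, ?_⟩
      by_cases hki : k = i
      · subst hki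
        rw [hfull]; exact (hVs k).2.1 hk
      · rwa [hVk k hki] at hk
  · intro heq
    obtain ⟨x, hx, hxP⟩ := (XX_infinite (c := ((i : ℕ) : ℤ)) h01).exists_notMem_finite hPfin
    have hxZ : x ∈ Z := by rw [hZ]; exact Set.mem_iUnion.2 ⟨i, by rw [hfull]; exact hx⟩
    rw [← heq] at hxZ
    obtain ⟨k, hk⟩ := Set.mem_iUnion.1 hxZ
    have := same_index (m := 0) hx ((hVs k).2.1 hk) (fun _ _ => rfl)
    subst this
    rw [hVi] at hk
    exact hxP hk

end family

/-- For `d ≥ 2` the Cantor–Bendixson rank of `S^d` is infinite: every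
Cantor–Bendixson derivative of `S^d` contains an isolated point, hence each derivative
strictly contains the next one. -/
theorem CantorBendixson_rank_infinite
    (d : ℕ) (hd : 2 ≤ d) :
    ∀ n : ℕ, (∃ X : Set (Config d), X ∈ CBderiv d n ∧ IsolatedIn (CBderiv d n) X) ∧
      CBderiv d (n + 1) ⊂ CBderiv d n := by
  have h01 : (⟨0, by omega⟩ : Fin d) ≠ ⟨1, by omega⟩ := by simp
  generalize (⟨0, by omega⟩ : Fin d) = i0 at h01
  generalize (⟨1, by omega⟩ : Fin d) = i1 at h01
  intro n
  have hstart : PP i0 i1 n (n + 1) (⋃ i : Fin (n + 1), XX i0 i1 ((i : ℕ) : ℤ)) := by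
    refine ⟨fun i => XX i0 i1 ((i : ℕ) : ℤ), fun i => ?_, rfl, by simp [Set.ncard_univ]⟩
    exact ⟨(XX_infinite h01).nonempty, subset_rfl, XX_closed, fun u z hz => XX_shift u hz⟩
  obtain ⟨W, hW, -, -⟩ := PP_b h01 n _ hstart 1 one_pos
  have hmain := CB_abstract (PP i0 i1 n) PP_shift (PP_a h01) (PP_b h01) n W hW
  refine ⟨⟨W, hmain⟩, ?_⟩
  refine ⟨CBderiv_anti d n 1, fun h => ?_⟩
  exact (h hmain.1).2 hmain.2
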